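/- arXiv:1709.04355 — 3 statements merged into one kernel-verified Lean document; each statement's English description precedes it below -/
import Mathlib

section
/- Let K be a compact metric space and let (M_n)_{n∈ℕ} and M be random finite nonnegative Borel measures on K (not necessarily on a common probability space). If for every nonnegative continuous function f : K → ℝ the real random variables ∫_K f dM_n converge in distribution to ∫_K f dM, then M_n converges to M in distribution as random elements of the space of finite nonnegative Borel measures on K equipped with the topology of weak convergence. -/
open MeasureTheory ProbabilityTheory Filter Topology BoundedContinuousFunction

/-- A real sequence that is eventually arbitrarily well approximated by convergent sequences with
nearby limits converges. -/
theorem tendsto_of_forall_approx {a : ℕ → ℝ} {l : ℝ}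
    (h : ∀ ε > 0, ∃ (b : ℕ → ℝ) (m : ℝ), Tendsto b atTop (𝓝 m) ∧
      (∀ᶠ n in atTop, |a n - b n| ≤ ε) ∧ |l - m| ≤ ε) :
    Tendsto a atTop (𝓝 l) := by
  rw [Metric.tendsto_nhds]
  intro ε hε
  obtain ⟨b, m, hb, hab, hlm⟩ := h (ε / 4) (by positivity)
  filter_upwards [Metric.tendsto_nhds.1 hb (ε / 4) (by positivity), hab] with n hn hn'
  rw [Real.dist_eq] at *
  rw [abs_le] at hlm hn'
  rw [abs_lt] at *
  constructor <;> linarith [hlm.1, hlm.2, hn'.1, hn'.2, hn.1, hn.2]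

/-- A continuous real function composed with a Borel map is measurable. -/
theorem Continuous.measurable_comp_of_borel {α X : Type*} [MeasurableSpace α] [TopologicalSpace X]
    {m : α → X} (hm : @Measurable α X _ (borel X) m) {F : X → ℝ} (hF : Continuous F) :
    Measurable fun a => F (m a) := by
  let : MeasurableSpace X := borel X
  have : BorelSpace X := ⟨rfl⟩
  exact hF.measurable.comp hm

/-- On a probability space, the expectations of two integrable variables that are uniformly
`ε`-close differ by at most `ε`. -/
theorem abs_integral_sub_integral_le {α : Type*} [MeasurableSpace α] {P : Measure α}
    [IsProbabilityMeasure P] {u v : α → ℝ} {ε : ℝ} (hu : Integrable u P) (hv : Integrable v P)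
    (h : ∀ a, |u a - v a| ≤ ε) : |∫ a, u a ∂P - ∫ a, v a ∂P| ≤ ε := by
  rw [← integral_sub hu hv]
  simpa using norm_integral_le_of_norm_le_const (μ := P) (f := fun a => u a - v a)
    (Eventually.of_forall h)

/-- A continuous function on a compact space, composed with a measurable map, is integrable. -/
theorem ContinuousMap.integrable_comp {α Y : Type*} [MeasurableSpace α] {P : Measure α}
    [IsProbabilityMeasure P] [TopologicalSpace Y] [CompactSpace Y] {m : α → Y} (F : C(Y, ℝ))
    (hF : Measurable fun a => F (m a)) : Integrable (fun a => F (m a)) P :=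
  Integrable.of_bound hF.aestronglyMeasurable ‖F‖
    (Eventually.of_forall fun a => F.norm_coe_le_norm (m a))

/-- On a compact space, convergence of expectations of a multiplicative family of continuous
functions that separates points implies convergence for all continuous functions. -/
theorem tendsto_integral_of_submonoid_separatesPoints {Y : Type*} [TopologicalSpace Y]
    [CompactSpace Y] {Ω : ℕ → Type*} [∀ n, MeasurableSpace (Ω n)] {P : ∀ n, Measure (Ω n)}
    [∀ n, IsProbabilityMeasure (P n)] {Ω' : Type*} [MeasurableSpace Ω'] {P' : Measure Ω'}
    [IsProbabilityMeasure P'] {m : ∀ n, Ω n → Y} {m' : Ω' → Y}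
    (hm : ∀ n (F : C(Y, ℝ)), Measurable fun ω => F (m n ω))
    (hm' : ∀ F : C(Y, ℝ), Measurable fun ω => F (m' ω))
    (S : Submonoid C(Y, ℝ)) (hS : ∀ x y : Y, x ≠ y → ∃ F ∈ S, F x ≠ F y)
    (h : ∀ F ∈ S, Tendsto (fun n => ∫ ω, F (m n ω) ∂P n) atTop (𝓝 (∫ ω, F (m' ω) ∂P')))
    (F : C(Y, ℝ)) :
    Tendsto (fun n => ∫ ω, F (m n ω) ∂P n) atTop (𝓝 (∫ ω, F (m' ω) ∂P')) := by
  have int n (F : C(Y, ℝ)) : Integrable (fun ω => F (m n ω)) (P n) := F.integrable_comp (hm n F)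
  have int' (F : C(Y, ℝ)) : Integrable (fun ω => F (m' ω)) P' := F.integrable_comp (hm' F)
  have key (A : C(Y, ℝ)) (hA : A ∈ Algebra.adjoin ℝ (S : Set C(Y, ℝ))) :
      Tendsto (fun n => ∫ ω, A (m n ω) ∂P n) atTop (𝓝 (∫ ω, A (m' ω) ∂P')) := by
    rw [← Subalgebra.mem_toSubmodule, Algebra.adjoin_eq_span, Submonoid.closure_eq] at hA
    induction hA using Submodule.span_induction with
    | mem A hA => exact h A hA
    | zero => simp
    | add A B _ _ hA hB =>
      simp only [ContinuousMap.add_apply]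
      rw [integral_add (int' A) (int' B)]
      simp_rw [fun n => integral_add (int n A) (int n B)]
      exact hA.add hB
    | smul c A _ hA =>
      simp only [ContinuousMap.smul_apply, smul_eq_mul, integral_const_mul]
      exact hA.const_mul c
  have sep : (Algebra.adjoin ℝ (S : Set C(Y, ℝ))).SeparatesPoints := by
    intro x y hxy
    obtain ⟨F, hF, hne⟩ := hS x y hxy
    exact ⟨F, ⟨F, Algebra.subset_adjoin hF, rfl⟩, hne⟩
  refine tendsto_of_forall_approx fun ε hε => ?_
  obtain ⟨⟨A, hA⟩, hAF⟩ :=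
    ContinuousMap.exists_mem_subalgebra_near_continuousMap_of_separatesPoints _ sep F ε hε
  have close (y : Y) : |F y - A y| ≤ ε := by
    rw [abs_sub_comm]
    exact ((A - F).norm_coe_le_norm y).trans hAF.le
  exact ⟨_, _, key A hA,
    Eventually.of_forall fun n => abs_integral_sub_integral_le (int n F) (int n A) fun _ => close _,
    abs_integral_sub_integral_le (int' F) (int' A) fun _ => close _⟩

namespace MeasureTheory.FiniteMeasure

variable {K : Type*} [MetricSpace K] [CompactSpace K] [MeasurableSpace K] [BorelSpace K]

theorem integrable_continuousMap (μ : FiniteMeasure K) (f : C(K, ℝ)) :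
    Integrable (fun x => f x) (μ : Measure K) :=
  Integrable.of_bound f.continuous.measurable.aestronglyMeasurable ‖f‖
    (Eventually.of_forall f.norm_coe_le_norm)

/-- On a compact space, the mass tends to infinity at infinity of the space of finite measures. -/
theorem tendsto_mass_coclosedCompact :
    Tendsto (fun μ : FiniteMeasure K => (μ.mass : ℝ)) (coclosedCompact (FiniteMeasure K))
      atTop := by
  rw [tendsto_atTop]
  intro C
  refine mem_of_superset ((isCompact_setOfPred_finiteMeasure_le_of_compactSpace K
    C.toNNReal).compl_mem_coclosedCompact_of_isClosed
    (isClosed_le continuous_mass continuous_const)) fun μ hμ => ?_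
  have : C.toNNReal < μ.mass := not_le.1 hμ
  exact (Real.le_coe_toNNReal C).trans (NNReal.coe_le_coe.2 this.le)

/-- The Laplace functional of a continuous function bounded below by `1`, extended by `0` at
infinity. -/
noncomputable def laplaceOnePoint (f : C(K, ℝ)) (hf : ∀ x, 1 ≤ f x) :
    C(OnePoint (FiniteMeasure K), ℝ) :=
  OnePoint.continuousMapMk
    ⟨fun μ => Real.exp (-∫ x, f x ∂(μ : Measure K)),
      Real.continuous_exp.comp (continuous_integral_continuousMap f).neg⟩ 0 <| by
    refine Real.tendsto_exp_neg_atTop_nhds_zero.comp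
      (tendsto_atTop_mono (fun μ => ?_) tendsto_mass_coclosedCompact)
    have := integral_mono (integrable_const (1 : ℝ)) (μ.integrable_continuousMap f) hf
    rwa [integral_const, smul_eq_mul, mul_one] at this

/-- The multiplicative family of continuous functions on the one-point compactification of the
space of finite measures which restrict to Laplace functionals. -/
noncomputable def laplaceSubmonoid (K : Type*) [MetricSpace K] [CompactSpace K] [MeasurableSpace K]
    [BorelSpace K] : Submonoid C(OnePoint (FiniteMeasure K), ℝ) where
  carrier := {F | ∃ f : C(K, ℝ), (∀ x, 0 ≤ f x) ∧
    ∀ μ : FiniteMeasure K, F μ = Real.exp (-∫ x, f x ∂(μ : Measure K))}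
  one_mem' := ⟨0, by simp, by simp⟩
  mul_mem' := by
    rintro F G ⟨f, hf, hF⟩ ⟨g, hg, hG⟩
    refine ⟨f + g, fun x => add_nonneg (hf x) (hg x), fun μ => ?_⟩
    simp only [ContinuousMap.mul_apply, ContinuousMap.add_apply, hF, hG]
    rw [integral_add (μ.integrable_continuousMap f) (μ.integrable_continuousMap g), neg_add,
      Real.exp_add]

theorem laplaceOnePoint_mem_laplaceSubmonoid (f : C(K, ℝ)) (hf : ∀ x, 1 ≤ f x) :
    laplaceOnePoint f hf ∈ laplaceSubmonoid K :=
  ⟨f, fun x => zero_le_one.trans (hf x), fun _ => rfl⟩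

theorem eq_of_forall_integral_eq_of_one_le {K : Type*} [MetricSpace K] [MeasurableSpace K]
    [BorelSpace K] {μ ν : FiniteMeasure K}
    (h : ∀ f : C(K, ℝ), (∀ x, 1 ≤ f x) →
      ∫ x, f x ∂(μ : Measure K) = ∫ x, f x ∂(ν : Measure K)) : μ = ν := by
  refine ext_of_forall_integral_eq fun f => ?_
  have h1 := h 1 fun _ => le_rfl
  have h2 := h (f.toContinuousMap + ContinuousMap.const K (‖f‖ + 1)) fun x => by
    have := neg_le_of_abs_le (f.norm_coe_le_norm x)
    simp only [ContinuousMap.add_apply, ContinuousMap.const_apply, coe_toContinuousMap]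
    linarith
  simp only [ContinuousMap.add_apply, ContinuousMap.const_apply, coe_toContinuousMap] at h2
  rw [integral_add (f.integrable _) (integrable_const _),
    integral_add (f.integrable _) (integrable_const _)] at h2
  simp only [ContinuousMap.one_apply, integral_const, smul_eq_mul, mul_one] at h1 h2
  rw [h1] at h2
  exact add_right_cancel h2

theorem laplaceSubmonoid_separates (x y : OnePoint (FiniteMeasure K)) (hxy : x ≠ y) :
    ∃ F ∈ laplaceSubmonoid K, F x ≠ F y := by
  induction x using OnePoint.rec with
  | infty =>
    induction y using OnePoint.rec with
    | infty => exact absurd rfl hxy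
    | coe ν =>
      exact ⟨_, laplaceOnePoint_mem_laplaceSubmonoid 1 fun _ => le_rfl, (Real.exp_pos _).ne⟩
  | coe μ =>
    induction y using OnePoint.rec with
    | infty =>
      exact ⟨_, laplaceOnePoint_mem_laplaceSubmonoid 1 fun _ => le_rfl, (Real.exp_pos _).ne'⟩
    | coe ν =>
      by_contra! hall
      refine hxy (congrArg _ (eq_of_forall_integral_eq_of_one_le fun f hf => ?_))
      exact neg_injective
        (Real.exp_injective (hall _ (laplaceOnePoint_mem_laplaceSubmonoid f hf)))

end MeasureTheory.FiniteMeasure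

/-- The continuous cutoff equal to `1` on `(-∞, k]` and to `0` on `[k + 1, ∞)`. -/
noncomputable def cutoff (k : ℕ) : ℝ →ᵇ ℝ :=
  BoundedContinuousFunction.ofNormedAddCommGroup (fun t => max 0 (min 1 (k + 1 - t)))
    (by fun_prop) 1 fun t => by
      rw [Real.norm_eq_abs, abs_of_nonneg (le_max_left _ _)]
      exact max_le zero_le_one (min_le_left _ _)

theorem cutoff_apply (k : ℕ) (t : ℝ) : cutoff k t = max 0 (min 1 (k + 1 - t)) := rfl

theorem cutoff_nonneg (k : ℕ) (t : ℝ) : 0 ≤ cutoff k t := le_max_left _ _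

theorem cutoff_le_one (k : ℕ) (t : ℝ) : cutoff k t ≤ 1 := max_le zero_le_one (min_le_left _ _)

theorem cutoff_of_le {k : ℕ} {t : ℝ} (h : t ≤ k) : cutoff k t = 1 := by
  rw [cutoff_apply, min_eq_left (by linarith), max_eq_right zero_le_one]

theorem cutoff_of_ge {k : ℕ} {t : ℝ} (h : k + 1 ≤ t) : cutoff k t = 0 :=
  max_eq_left ((min_le_right _ _).trans (by linarith))

/-- Cutting off costs at most the bound times the mass of the tail. -/
theorem abs_integral_sub_integral_mul_cutoff_le {α : Type*} [MeasurableSpace α] {P : Measure α}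
    [IsProbabilityMeasure P] {u t : α → ℝ} {C : ℝ} (hu : Measurable u) (ht : Measurable t)
    (hC : ∀ a, |u a| ≤ C) (k : ℕ) :
    |∫ a, u a ∂P - ∫ a, u a * cutoff k (t a) ∂P| ≤ C * (1 - ∫ a, cutoff k (t a) ∂P) := by
  have hc : Measurable fun a => cutoff k (t a) := (cutoff k).continuous.measurable.comp ht
  have ic : Integrable (fun a => cutoff k (t a)) P :=
    Integrable.of_bound hc.aestronglyMeasurable 1 (Eventually.of_forall fun a => by
      rw [Real.norm_eq_abs, abs_of_nonneg (cutoff_nonneg _ _)]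
      exact cutoff_le_one _ _)
  have iu : Integrable u P :=
    Integrable.of_bound hu.aestronglyMeasurable C (Eventually.of_forall hC)
  have iuc : Integrable (fun a => u a * cutoff k (t a)) P :=
    ic.bdd_mul hu.aestronglyMeasurable (Eventually.of_forall hC)
  have hr : C * (1 - ∫ a, cutoff k (t a) ∂P) = ∫ a, C * (1 - cutoff k (t a)) ∂P := by
    rw [integral_const_mul, integral_sub (integrable_const _) ic]
    simp
  rw [← integral_sub iu iuc, hr]
  refine norm_integral_le_of_norm_le (G := ℝ) (((integrable_const (1 : ℝ)).sub ic).const_mul C)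
    (Eventually.of_forall fun a => ?_)
  have h1 : 0 ≤ 1 - cutoff k (t a) := sub_nonneg.2 (cutoff_le_one _ _)
  rw [← mul_one_sub, norm_mul, Real.norm_eq_abs, Real.norm_eq_abs, abs_of_nonneg h1]
  exact mul_le_mul_of_nonneg_right (hC a) h1

theorem tendsto_integral_cutoff {α : Type*} [MeasurableSpace α] {P : Measure α}
    [IsProbabilityMeasure P] {t : α → ℝ} (ht : Measurable t) :
    Tendsto (fun k => ∫ a, cutoff k (t a) ∂P) atTop (𝓝 1) := by
  have := tendsto_integral_of_dominated_convergence (μ := P) (F := fun k a => cutoff k (t a))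
    (f := fun _ => (1 : ℝ)) (fun _ => 1)
    (fun k => ((cutoff k).continuous.measurable.comp ht).aestronglyMeasurable)
    (integrable_const _)
    (fun k => Eventually.of_forall fun a => by
      rw [Real.norm_eq_abs, abs_of_nonneg (cutoff_nonneg _ _)]
      exact cutoff_le_one _ _)
    (Eventually.of_forall fun a => by
      obtain ⟨N, hN⟩ := exists_nat_ge (t a)
      refine tendsto_const_nhds.congr' ?_
      filter_upwards [eventually_ge_atTop N] with k hk
      exact (cutoff_of_le (hN.trans (by exact_mod_cast hk))).symm)
  simpa using this

/-- The bounded continuous function `t ↦ exp (-t⁺)`. -/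
noncomputable def expNegPosPart : ℝ →ᵇ ℝ :=
  BoundedContinuousFunction.ofNormedAddCommGroup (fun t => Real.exp (-max t 0))
    (by fun_prop) 1 fun t => by
      rw [Real.norm_eq_abs, Real.abs_exp, Real.exp_le_one_iff]
      exact neg_nonpos.2 (le_max_right _ _)

theorem expNegPosPart_of_nonneg {t : ℝ} (ht : 0 ≤ t) : expNegPosPart t = Real.exp (-t) :=
  congrArg (fun s => Real.exp (-s)) (max_eq_left ht)

/-- A bounded continuous function of finite measures, cut off at large mass, as a continuous
function on the one-point compactification. -/
noncomputable def MeasureTheory.FiniteMeasure.mulCutoffOnePoint {K : Type*} [MetricSpace K]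
    [CompactSpace K] [MeasurableSpace K] [BorelSpace K] (G : FiniteMeasure K →ᵇ ℝ) (k : ℕ) :
    C(OnePoint (FiniteMeasure K), ℝ) :=
  OnePoint.continuousMapMk
    ⟨fun μ => G μ * cutoff k μ.mass, G.continuous.mul ((cutoff k).continuous.comp
      (NNReal.continuous_coe.comp FiniteMeasure.continuous_mass))⟩ 0 <| by
    refine tendsto_const_nhds.congr' ?_
    filter_upwards [FiniteMeasure.tendsto_mass_coclosedCompact.eventually_ge_atTop (k + 1 : ℝ)]
      with μ hμ
    simp [cutoff_of_ge hμ]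

/-- **Convergence in distribution of random finite measures from convergence in distribution of
integrals of nonnegative continuous test functions.**
If `(Mₙ)` and `M` are random finite nonnegative Borel measures on a compact metric space `K`
(possibly on different probability spaces) and for every nonnegative continuous `f : K → ℝ`
the real random variables `∫ f dMₙ` converge in distribution to `∫ f dM`, then `Mₙ → M` in
distribution as random elements of the space of finite measures with the topology of weak
convergence. Convergence in distribution is expressed by testing against bounded continuous
functions. -/
theorem random_measure_tendsto_in_distribution
    {K : Type*} [MetricSpace K] [CompactSpace K] [MeasurableSpace K] [BorelSpace K]
    {Ω : ℕ → Type*} [∀ n, MeasureSpace (Ω n)] [∀ n, IsProbabilityMeasure (ℙ : Measure (Ω n))]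
    {Ω' : Type*} [MeasureSpace Ω'] [IsProbabilityMeasure (ℙ : Measure Ω')]
    (M : ∀ n, Ω n → FiniteMeasure K) (Mlim : Ω' → FiniteMeasure K)
    (hM : ∀ n, @Measurable (Ω n) (FiniteMeasure K) _ (borel _) (M n))
    (hMlim : @Measurable Ω' (FiniteMeasure K) _ (borel _) Mlim)
    (h : ∀ f : C(K, ℝ), (∀ x, 0 ≤ f x) →
      ∀ g : ℝ →ᵇ ℝ,
        Tendsto (fun n => ∫ ω, g (∫ x, f x ∂(M n ω : Measure K)) ∂(ℙ : Measure (Ω n)))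
          atTop (𝓝 (∫ ω, g (∫ x, f x ∂(Mlim ω : Measure K)) ∂(ℙ : Measure Ω')))) :
    ∀ G : FiniteMeasure K →ᵇ ℝ,
      Tendsto (fun n => ∫ ω, G (M n ω) ∂(ℙ : Measure (Ω n))) atTop
        (𝓝 (∫ ω, G (Mlim ω) ∂(ℙ : Measure Ω'))) := by
  have meas n {F : FiniteMeasure K → ℝ} (hF : Continuous F) : Measurable fun ω => F (M n ω) :=
    hF.measurable_comp_of_borel (hM n)
  have meas' {F : FiniteMeasure K → ℝ} (hF : Continuous F) : Measurable fun ω => F (Mlim ω) :=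
    hF.measurable_comp_of_borel hMlim
  have mass_cont : Continuous fun μ : FiniteMeasure K => (μ.mass : ℝ) :=
    NNReal.continuous_coe.comp FiniteMeasure.continuous_mass
  have onePoint (F : C(OnePoint (FiniteMeasure K), ℝ)) :
      Tendsto (fun n => ∫ ω, F (M n ω) ∂(ℙ : Measure (Ω n))) atTop
        (𝓝 (∫ ω, F (Mlim ω) ∂(ℙ : Measure Ω'))) := by
    refine tendsto_integral_of_submonoid_separatesPoints
      (P := fun n => (ℙ : Measure (Ω n))) (P' := (ℙ : Measure Ω'))
      (m := fun n ω => (M n ω : OnePoint (FiniteMeasure K))) (m' := fun ω => (Mlim ω : OnePoint _))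
      (fun n F => meas n (F.continuous.comp OnePoint.continuous_coe))
      (fun F => meas' (F.continuous.comp OnePoint.continuous_coe))
      (FiniteMeasure.laplaceSubmonoid K) FiniteMeasure.laplaceSubmonoid_separates ?_ F
    rintro F ⟨f, hf, hF⟩
    have (μ : FiniteMeasure K) : F μ = expNegPosPart (∫ x, f x ∂(μ : Measure K)) := by
      rw [hF, expNegPosPart_of_nonneg (integral_nonneg hf)]
    simp_rw [this]
    exact h f hf expNegPosPart
  have tail k : Tendsto (fun n => ∫ ω, cutoff k (M n ω).mass ∂(ℙ : Measure (Ω n))) atTop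
      (𝓝 (∫ ω, cutoff k (Mlim ω).mass ∂(ℙ : Measure Ω'))) := by
    have mass_eq (μ : FiniteMeasure K) :
        ∫ x, (1 : C(K, ℝ)) x ∂(μ : Measure K) = μ.mass := by
      simp [FiniteMeasure.mass]
    simpa only [mass_eq] using h 1 (fun _ => zero_le_one) (cutoff k)
  intro G
  refine tendsto_of_forall_approx fun ε hε => ?_
  have hlim : Tendsto (fun k => ‖G‖ * (1 - ∫ ω, cutoff k (Mlim ω).mass ∂(ℙ : Measure Ω'))) atTop
      (𝓝 0) := by
    simpa using ((tendsto_integral_cutoff (P := (ℙ : Measure Ω'))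
      (meas' mass_cont)).const_sub 1).const_mul ‖G‖
  obtain ⟨k, hk⟩ := (hlim.eventually_lt_const hε).exists
  refine ⟨_, _, onePoint (FiniteMeasure.mulCutoffOnePoint G k), ?_, ?_⟩
  · filter_upwards [(((tail k).const_sub 1).const_mul ‖G‖).eventually_lt_const hk] with n hn
    exact (abs_integral_sub_integral_mul_cutoff_le (P := (ℙ : Measure (Ω n))) (meas n G.continuous) (meas n mass_cont)
      (fun ω => G.norm_coe_le_norm _) k).trans hn.le
  · exact (abs_integral_sub_integral_mul_cutoff_le (P := (ℙ : Measure Ω')) (meas' G.continuous) (meas' mass_cont)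
      (fun ω => G.norm_coe_le_norm _) k).trans hk.le
end

section
/- (Kahane convexity inequality) Let K ⊂ ℝ² be compact with positive Lebesgue measure and let Γ₁, Γ₂ be continuous centered Gaussian fields on K with covariance kernels C₁, C₂ satisfying C₁(z,w) ≤ C₂(z,w) for all z, w ∈ K. Then for every convex function f : [0,∞) → ℝ of at most polynomial growth, E[f(∫_K e^{Γ₁(z) − C₁(z,z)/2} dz)] ≤ E[f(∫_K e^{Γ₂(z) − C₂(z,z)/2} dz)]. Moreover, the opposite inequality holds for every concave f : [0,∞) → ℝ of at most polynomial growth. -/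
open MeasureTheory ProbabilityTheory Real

/-- A continuous centered Gaussian field on a set `K ⊂ ℝ²` (modelled by
`EuclideanSpace ℝ (Fin 2)`), with covariance kernel `C`: a jointly measurable process with
almost surely continuous sample paths on `K`, all of whose finite linear combinations of values
at points of `K` are centered Gaussian random variables, with `C z w = E[Γ(z)Γ(w)]` continuous
on `K × K`. -/
def IsContGaussianField {Ω : Type*} [MeasureSpace Ω]
    (K : Set (EuclideanSpace ℝ (Fin 2)))
    (Γ : Ω → EuclideanSpace ℝ (Fin 2) → ℝ)
    (C : EuclideanSpace ℝ (Fin 2) → EuclideanSpace ℝ (Fin 2) → ℝ) : Prop :=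
  Measurable (Function.uncurry Γ) ∧
  (∀ᵐ ω ∂(ℙ : Measure Ω), ContinuousOn (Γ ω) K) ∧
  (∀ (n : ℕ) (a : Fin n → ℝ) (z : Fin n → EuclideanSpace ℝ (Fin 2)), (∀ j, z j ∈ K) →
    ∃ v : NNReal,
      Measure.map (fun ω => ∑ j, a j * Γ ω (z j)) (ℙ : Measure Ω) = gaussianReal 0 v) ∧
  (∀ z ∈ K, ∀ w ∈ K, C z w = ∫ ω, Γ ω z * Γ ω w) ∧
  ContinuousOn (fun p : EuclideanSpace ℝ (Fin 2) × EuclideanSpace ℝ (Fin 2) => C p.1 p.2)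
    (K ×ˢ K)

open scoped NNReal

/-- **Stein's lemma** for a centered real Gaussian measure. -/
lemma integral_id_mul_gaussianReal (v : ℝ≥0) {h h' : ℝ → ℝ} (hh : ∀ x, HasDerivAt h (h' x) x)
    (hint : Integrable h (gaussianReal 0 v))
    (hint_mul : Integrable (fun x ↦ x * h x) (gaussianReal 0 v))
    (hint' : Integrable h' (gaussianReal 0 v)) :
    ∫ x, x * h x ∂(gaussianReal 0 v) = v * ∫ x, h' x ∂(gaussianReal 0 v) := by
  by_cases hv : v = 0
  · subst hv
    simp [gaussianReal_zero_var]
  have hv' : (v : ℝ) ≠ 0 := by exact_mod_cast hv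
  have key : ∀ g : ℝ → ℝ, Integrable g (gaussianReal 0 v) →
      Integrable (fun x ↦ gaussianPDFReal 0 v x * g x) := by
    intro g hg
    rw [gaussianReal_of_var_ne_zero _ hv, integrable_withDensity_iff_integrable_smul₀'
      (by fun_prop) (Filter.Eventually.of_forall fun _ ↦ gaussianPDF_lt_top)] at hg
    simpa [toReal_gaussianPDF] using hg
  have hpdf : ∀ x, HasDerivAt (gaussianPDFReal 0 v) (-(x / v) * gaussianPDFReal 0 v x) x := by
    intro x
    have h1 : HasDerivAt (fun x : ℝ ↦ -(x - 0) ^ 2 / (2 * v)) (-(x / v)) x := by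
      have := ((((hasDerivAt_id x).sub_const 0).pow 2).neg.div_const (2 * (v : ℝ)))
      refine this.congr_deriv ?_
      simp
      field_simp
    have := h1.exp.const_mul (√(2 * π * v))⁻¹
    rw [gaussianPDFReal_def]
    refine this.congr_deriv ?_
    ring
  rw [integral_gaussianReal_eq_integral_smul hv, integral_gaussianReal_eq_integral_smul hv]
  have h1 := key _ hint
  have h2 := (key _ hint_mul).div_const (-(v : ℝ))
  have h3 := key _ hint'
  have := integral_mul_deriv_eq_deriv_mul_of_integrable (u := h) (v := gaussianPDFReal 0 v)
    (u' := h') (v' := fun x ↦ -(x / v) * gaussianPDFReal 0 v x) (fun x _ ↦ hh x)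
    (fun x _ ↦ hpdf x) ?_ ?_ ?_
  · have e1 : ∀ x, h x * (-(x / v) * gaussianPDFReal 0 v x)
        = (gaussianPDFReal 0 v x • (x * h x)) * (-(v : ℝ))⁻¹ := by
      intro x; simp only [smul_eq_mul]; field_simp
    simp_rw [e1, integral_mul_const] at this
    have e2 : ∀ x, h' x * gaussianPDFReal 0 v x = gaussianPDFReal 0 v x • h' x := by
      intro x; simp [mul_comm]
    simp_rw [e2] at this
    field_simp at this
    linarith
  · refine h2.congr (Filter.Eventually.of_forall fun x ↦ ?_)
    simp only [Pi.mul_apply]; field_simp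
  · refine h3.congr (Filter.Eventually.of_forall fun x ↦ ?_)
    simp [mul_comm]
  · refine h1.congr (Filter.Eventually.of_forall fun x ↦ ?_)
    simp [mul_comm]

namespace ProbabilityTheory.HasGaussianLaw

variable {Ω E : Type*} {mΩ : MeasurableSpace Ω} {P : Measure Ω}
  [NormedAddCommGroup E] [NormedSpace ℝ E] [MeasurableSpace E] [BorelSpace E]
  [SecondCountableTopology E] [CompleteSpace E]

lemma integrable_exp_mul_norm {X : Ω → E} (hX : HasGaussianLaw X P) (a : ℝ) :
    Integrable (fun ω ↦ exp (a * ‖X ω‖)) P := by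
  have := hX.isGaussian_map
  obtain ⟨C, hC, hint⟩ := IsGaussian.exists_integrable_exp_sq (P.map X)
  have h2 := ((integrable_map_measure (by fun_prop) (by fun_prop)).1 hint).const_mul
    (exp (a ^ 2 / (4 * C)))
  have hXm : AEMeasurable X P := hX.aemeasurable
  refine h2.mono' (AEMeasurable.aestronglyMeasurable (by fun_prop))
    (Filter.Eventually.of_forall fun ω ↦ ?_)
  simp only [norm_eq_abs, abs_exp, Function.comp_apply]
  rw [← exp_add, exp_le_exp]
  have : a ^ 2 / (4 * C) + C * ‖X ω‖ ^ 2 - a * ‖X ω‖ = (a - 2 * C * ‖X ω‖) ^ 2 / (4 * C) := by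
    field_simp; ring
  have h0 : 0 ≤ (a - 2 * C * ‖X ω‖) ^ 2 / (4 * C) := by positivity
  linarith

end ProbabilityTheory.HasGaussianLaw

/-- At most exponential growth at infinity. -/
def HasExpGrowth {E : Type*} [NormedAddCommGroup E] (G : E → ℝ) : Prop :=
  ∃ K : ℝ, 0 ≤ K ∧ ∀ x, |G x| ≤ K * exp (K * ‖x‖)

namespace HasExpGrowth

variable {E F : Type*} [NormedAddCommGroup E] [NormedAddCommGroup F] {G H : E → ℝ}

lemma of_le {a b : ℝ} (ha : 0 ≤ a) (hG : ∀ x, |G x| ≤ a * exp (b * ‖x‖)) : HasExpGrowth G := by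
  refine ⟨max a b, le_max_of_le_left ha, fun x ↦ (hG x).trans ?_⟩
  gcongr
  · exact le_max_left _ _
  · exact le_max_right _ _

lemma of_bounded {a : ℝ} (hG : ∀ x, |G x| ≤ a) : HasExpGrowth G :=
  of_le (b := 0) ((abs_nonneg _).trans (hG 0)) (by simpa using hG)

lemma mul (hG : HasExpGrowth G) (hH : HasExpGrowth H) : HasExpGrowth (fun x ↦ G x * H x) := by
  obtain ⟨K, hK, hG⟩ := hG
  obtain ⟨K', hK', hH⟩ := hH
  refine of_le (a := K * K') (b := K + K') (by positivity) fun x ↦ ?_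
  rw [abs_mul, add_mul, exp_add]
  calc |G x| * |H x| ≤ (K * exp (K * ‖x‖)) * (K' * exp (K' * ‖x‖)) := by
        gcongr
        · exact hG x
        · exact hH x
    _ = _ := by ring

lemma add (hG : HasExpGrowth G) (hH : HasExpGrowth H) : HasExpGrowth (fun x ↦ G x + H x) := by
  obtain ⟨K, hK, hG⟩ := hG
  obtain ⟨K', hK', hH⟩ := hH
  refine of_le (a := K + K') (b := K + K') (by positivity) fun x ↦ ?_
  refine (abs_add_le _ _).trans ((add_le_add (hG x) (hH x)).trans ?_)
  rw [add_mul]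
  gcongr <;> linarith

lemma const (a : ℝ) : HasExpGrowth (fun _ : E ↦ a) := of_bounded fun _ ↦ le_rfl

lemma const_mul (a : ℝ) (hG : HasExpGrowth G) : HasExpGrowth (fun x ↦ a * G x) := (const a).mul hG

lemma sum {ι : Type*} (s : Finset ι) {G : ι → E → ℝ} (hG : ∀ i, HasExpGrowth (G i)) :
    HasExpGrowth (fun x ↦ ∑ i ∈ s, G i x) := by
  classical
  induction s using Finset.induction_on with
  | empty => simpa using const 0
  | insert a s ha ih =>
    simp only [Finset.sum_insert ha]
    exact (hG a).add ih

lemma exp_of_le {b : ℝ} (hG : ∀ x, |G x| ≤ b * ‖x‖) : HasExpGrowth (fun x ↦ exp (G x)) := by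
  refine of_le (a := 1) (b := b) zero_le_one fun x ↦ ?_
  rw [abs_exp, one_mul]
  exact exp_le_exp.2 ((le_abs_self _).trans (hG x))

variable [NormedSpace ℝ E] [NormedSpace ℝ F]

lemma exp_clm (L : E →L[ℝ] ℝ) : HasExpGrowth (fun x ↦ exp (L x)) :=
  exp_of_le (b := ‖L‖) fun x ↦ L.le_opNorm x

lemma clm (L : E →L[ℝ] ℝ) : HasExpGrowth (fun x ↦ L x) := by
  refine of_le (a := 1) (b := ‖L‖) zero_le_one fun x ↦ (L.le_opNorm x).trans ?_
  linarith [add_one_le_exp (‖L‖ * ‖x‖)]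

lemma comp_clm (hG : HasExpGrowth G) (L : F →L[ℝ] E) : HasExpGrowth (fun x ↦ G (L x)) := by
  obtain ⟨K, hK, hG⟩ := hG
  refine of_le (a := K) (b := K * ‖L‖) hK fun x ↦ (hG _).trans ?_
  rw [mul_assoc]
  gcongr
  exact L.le_opNorm x

lemma integrable_comp {Ω : Type*} {mΩ : MeasurableSpace Ω} {P : Measure Ω} [MeasurableSpace E]
    [BorelSpace E] [SecondCountableTopology E] [CompleteSpace E] {X : Ω → E}
    (hG : HasExpGrowth G) (hX : HasGaussianLaw X P) (hGm : Measurable G) :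
    Integrable (fun ω ↦ G (X ω)) P := by
  obtain ⟨K, hK, hG⟩ := hG
  exact ((hX.integrable_exp_mul_norm K).const_mul K).mono'
    (hGm.comp_aemeasurable hX.aemeasurable).aestronglyMeasurable
    (Filter.Eventually.of_forall fun ω ↦ hG _)

end HasExpGrowth

namespace ProbabilityTheory.HasGaussianLaw

variable {Ω E : Type*} {mΩ : MeasurableSpace Ω} {P : Measure Ω}
  [NormedAddCommGroup E] [NormedSpace ℝ E] [MeasurableSpace E] [BorelSpace E]
  [SecondCountableTopology E] [CompleteSpace E]

/-- **Gaussian integration by parts**: if `(ξ, X)` is Gaussian with `ξ` centered and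
`c = Cov(ξ, X)`, then `E[ξ G(X)] = E[∂_c G(X)]`. -/
lemma integral_mul_comp {ξ : Ω → ℝ} {X : Ω → E}
    (hξX : HasGaussianLaw (fun ω ↦ (ξ ω, X ω)) P) (hξ : P[ξ] = 0) {c : E}
    (hc : ∀ L : StrongDual ℝ E, cov[ξ, L ∘ X; P] = L c) {G D : E → ℝ}
    (hG : ∀ x, HasDerivAt (fun s : ℝ ↦ G (x + s • c)) (D x) 0)
    (hGm : Measurable G) (hDm : Measurable D) (hGb : HasExpGrowth G) (hDb : HasExpGrowth D) :
    ∫ ω, ξ ω * G (X ω) ∂P = ∫ ω, D (X ω) ∂P := by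
  have := hξX.isProbabilityMeasure
  have hξg : HasGaussianLaw ξ P := hξX.fst
  have hXg : HasGaussianLaw X P := hξX.snd
  obtain ⟨v, hv⟩ : ∃ v : ℝ≥0, (v : ℝ) = Var[ξ; P] := ⟨⟨_, variance_nonneg _ _⟩, rfl⟩
  have hlaw : P.map ξ = gaussianReal 0 v := by
    rw [hξg.map_eq_gaussianReal, hξ, ← hv, Real.toNNReal_coe]
  by_cases hv0 : v = 0
  · have hξ0 : ξ =ᵐ[P] 0 := by
      have h0 : ∀ᵐ x ∂(P.map ξ), x = 0 := by
        rw [hlaw, hv0, gaussianReal_zero_var]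
        simp [ae_dirac_eq]
      exact ae_of_ae_map hξg.aemeasurable h0
    have hc0 : c = 0 := by
      by_contra hne
      obtain ⟨L, hL⟩ := SeparatingDual.exists_ne_zero (R := ℝ) hne
      apply hL
      rw [← hc L, covariance, hξ]
      refine integral_eq_zero_of_ae ?_
      filter_upwards [hξ0] with ω h
      simp [h]
    have hD0 : ∀ x, D x = 0 := by
      intro x
      have h1 := hG x
      simp only [hc0, smul_zero, add_zero] at h1
      exact h1.unique (hasDerivAt_const 0 (G x))
    simp only [hD0, integral_zero]
    refine integral_eq_zero_of_ae ?_
    filter_upwards [hξ0] with ω h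
    simp [h]
  have hv' : (v : ℝ) ≠ 0 := by exact_mod_cast hv0
  set R : Ω → E := fun ω ↦ X ω - (ξ ω / v) • c with hR
  have hξR : HasGaussianLaw (fun ω ↦ (ξ ω, R ω)) P := by
    have := hξX.map_fun ((ContinuousLinearMap.fst ℝ ℝ E).prod (ContinuousLinearMap.snd ℝ ℝ E -
      ((v : ℝ)⁻¹ • ContinuousLinearMap.fst ℝ ℝ E).smulRight c))
    refine this.congr (Filter.Eventually.of_forall fun ω ↦ ?_)
    simp [hR, div_eq_inv_mul]
  have hind : IndepFun ξ R P := by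
    refine hξR.indepFun_of_covariance_strongDual fun L₁ L₂ ↦ ?_
    have e1 : L₁ ∘ ξ = fun ω ↦ L₁ 1 * ξ ω := by
      ext ω
      have := L₁.map_smul (ξ ω) 1
      simpa [mul_comm] using this
    have e2 : L₂ ∘ R = (L₂ ∘ X) - fun ω ↦ (L₂ c / v) * ξ ω := by
      ext ω; simp [hR]; ring
    rw [e1, e2, covariance_const_mul_left, covariance_sub_right hξg.memLp_two
      (hXg.map L₂).memLp_two (hξg.memLp_two.const_mul _), covariance_const_mul_right,
      covariance_self hξg.aemeasurable, hc, ← hv]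
    field_simp
    ring
  have hprod : P.map (fun ω ↦ (ξ ω, R ω)) = (gaussianReal 0 v).prod (P.map R) := by
    rw [← hlaw]
    exact (indepFun_iff_map_prod_eq_prod_map_map hξg.aemeasurable hξR.snd.aemeasurable).1 hind
  have hXR : ∀ ω, X ω = R ω + (ξ ω / v) • c := fun ω ↦ by simp [hR]
  have hRm : AEMeasurable R P := hξR.snd.aemeasurable
  have hpm : AEMeasurable (fun ω ↦ (ξ ω, R ω)) P := hξR.aemeasurable
  have i1 : Integrable (fun ω ↦ G (X ω)) P := hGb.integrable_comp hXg hGm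
  have i2 : Integrable (fun ω ↦ D (X ω)) P := hDb.integrable_comp hXg hDm
  have i3 : Integrable (fun ω ↦ ξ ω * G (X ω)) P :=
    ((HasExpGrowth.clm (ContinuousLinearMap.fst ℝ ℝ E)).mul
      (hGb.comp_clm (ContinuousLinearMap.snd ℝ ℝ E))).integrable_comp hξX
      (measurable_fst.mul (hGm.comp measurable_snd))
  have hGm2 : Measurable (fun p : ℝ × E ↦ G (p.2 + (p.1 / v) • c)) := by fun_prop
  have hDm2 : Measurable (fun p : ℝ × E ↦ D (p.2 + (p.1 / v) • c)) := by fun_prop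
  have hGm3 : Measurable (fun p : ℝ × E ↦ p.1 * G (p.2 + (p.1 / v) • c)) := by fun_prop
  have tr : ∀ H : ℝ × E → ℝ, Measurable H → Integrable (fun ω ↦ H (ξ ω, R ω)) P →
      Integrable H ((gaussianReal 0 v).prod (P.map R)) ∧
      ∫ ω, H (ξ ω, R ω) ∂P = ∫ r, ∫ s, H (s, r) ∂(gaussianReal 0 v) ∂(P.map R) := by
    intro H hH hi
    have hi' : Integrable H ((gaussianReal 0 v).prod (P.map R)) := by
      rw [← hprod]
      exact (integrable_map_measure hH.aestronglyMeasurable hpm).2 hi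
    have : IsProbabilityMeasure (P.map R) := Measure.isProbabilityMeasure_map hRm
    refine ⟨hi', ?_⟩
    rw [← integral_prod_symm _ hi', ← hprod, integral_map hpm hH.aestronglyMeasurable]
  obtain ⟨j1, -⟩ := tr _ hGm2 (by simpa only [← hXR] using i1)
  obtain ⟨j2, e2⟩ := tr _ hDm2 (by simpa only [← hXR] using i2)
  obtain ⟨j3, e3⟩ := tr _ hGm3 (by simpa only [← hXR] using i3)
  have : IsProbabilityMeasure (P.map R) := Measure.isProbabilityMeasure_map hRm
  simp only [← hXR] at e2 e3
  rw [e2, e3]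
  refine integral_congr_ae ?_
  filter_upwards [j1.prod_left_ae, j2.prod_left_ae, j3.prod_left_ae] with r k1 k2 k3
  have hd : ∀ s : ℝ, HasDerivAt (fun s : ℝ ↦ G (r + (s / v) • c)) (D (r + (s / v) • c) / v) s := by
    intro s
    have h1 := hG (r + (s / v) • c)
    have h2 : HasDerivAt (fun t : ℝ ↦ (t - s) / v) ((v : ℝ)⁻¹) s := by
      simpa using ((hasDerivAt_id s).sub_const s).div_const (v : ℝ)
    have h3 := HasDerivAt.comp_of_eq s h1 h2 (by simp)
    refine (h3.congr_deriv (div_eq_mul_inv _ _).symm).congr_of_eventuallyEq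
      (Filter.Eventually.of_forall fun t ↦ ?_)
    simp only [Function.comp_apply, add_assoc, ← add_smul]
    congr 3
    ring
  have := integral_id_mul_gaussianReal v hd k1 k3 (k2.div_const _)
  rw [this, integral_div]
  field_simp

end ProbabilityTheory.HasGaussianLaw

section Discrete

variable {ι : Type*} [Fintype ι]

/-- The total mass `∑ᵢ wᵢ exp (xᵢ - aᵢ / 2)` of a finite family of exponentials. -/
noncomputable def wickMass (w a x : ι → ℝ) : ℝ := ∑ i, w i * exp (x i - a i / 2)

lemma hasExpGrowth_exp_sub (i : ι) (a : ℝ) : HasExpGrowth (fun x : ι → ℝ ↦ exp (x i - a)) := by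
  simp only [sub_eq_add_neg, exp_add, mul_comm _ (exp (-a))]
  exact (HasExpGrowth.exp_clm
    (ContinuousLinearMap.proj (R := ℝ) (φ := fun _ : ι ↦ ℝ) i)).const_mul _

lemma hasExpGrowth_wickMass (w a : ι → ℝ) : HasExpGrowth (wickMass w a) :=
  HasExpGrowth.sum _ fun i ↦ (hasExpGrowth_exp_sub i _).const_mul _

lemma measurable_wickMass (w a : ι → ℝ) : Measurable (wickMass w a) := by
  unfold wickMass
  fun_prop

/-- Derivative of the total mass along a curve. -/
lemma hasDerivAt_wickMass (w : ι → ℝ) {a x : ℝ → ι → ℝ} {a' x' : ι → ℝ} {t : ℝ}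
    (ha : ∀ i, HasDerivAt (fun s ↦ a s i) (a' i) t)
    (hx : ∀ i, HasDerivAt (fun s ↦ x s i) (x' i) t) :
    HasDerivAt (fun s ↦ wickMass w (a s) (x s))
      (∑ i, w i * (exp (x t i - a t i / 2) * (x' i - a' i / 2))) t :=
  HasDerivAt.fun_sum fun i _ ↦ (((hx i).sub ((ha i).div_const 2)).exp).const_mul (w i)

/-- Integration by parts for `exp (Xᵢ - aᵢ / 2) g(M)` where `M` is the total mass. -/
lemma integral_mul_exp_mul_comp_wickMass {Ω : Type*} {mΩ : MeasurableSpace Ω} {P : Measure Ω}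
    {ξ : Ω → ℝ} {X : Ω → ι → ℝ} (hξX : HasGaussianLaw (fun ω ↦ (ξ ω, X ω)) P) (hξ : P[ξ] = 0)
    {c : ι → ℝ} (hc : ∀ j, cov[ξ, fun ω ↦ X ω j; P] = c j) (w a : ι → ℝ)
    {g g' : ℝ → ℝ} (hg : ∀ x, HasDerivAt g (g' x) x) (hg'm : Measurable g') {C : ℝ}
    (hgb : ∀ x, |g x| ≤ C) (hgb' : ∀ x, |g' x| ≤ C) (i : ι) :
    let D : (ι → ℝ) → ℝ := fun x ↦ c i * (exp (x i - a i / 2) * g (wickMass w a x)) +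
      exp (x i - a i / 2) * (g' (wickMass w a x) * ∑ j, w j * (exp (x j - a j / 2) * c j))
    Integrable (fun ω ↦ exp (X ω i - a i / 2) * g (wickMass w a (X ω))) P ∧
    Integrable (fun ω ↦ ξ ω * (exp (X ω i - a i / 2) * g (wickMass w a (X ω)))) P ∧
    Integrable (fun ω ↦ D (X ω)) P ∧
    ∫ ω, ξ ω * (exp (X ω i - a i / 2) * g (wickMass w a (X ω))) ∂P = ∫ ω, D (X ω) ∂P := by
  intro D
  have hgm : Measurable g :=
    (continuous_iff_continuousAt.2 fun x ↦ (hg x).continuousAt).measurable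
  have hMm := measurable_wickMass w a
  have hG : HasExpGrowth (fun x : ι → ℝ ↦ exp (x i - a i / 2) * g (wickMass w a x)) :=
    (hasExpGrowth_exp_sub i _).mul (HasExpGrowth.of_bounded fun _ ↦ hgb _)
  have hD : HasExpGrowth D :=
    (hG.const_mul _).add ((hasExpGrowth_exp_sub i _).mul
      ((HasExpGrowth.of_bounded fun _ ↦ hgb' _).mul (HasExpGrowth.sum _ fun j ↦
        (((hasExpGrowth_exp_sub j _).mul (HasExpGrowth.const _)).const_mul _))))
  have hGm : Measurable (fun x : ι → ℝ ↦ exp (x i - a i / 2) * g (wickMass w a x)) := by fun_prop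
  have hDm : Measurable D := by fun_prop
  have hXg : HasGaussianLaw X P := hξX.snd
  refine ⟨hG.integrable_comp hXg hGm, ?_, hD.integrable_comp hXg hDm, ?_⟩
  · exact ((HasExpGrowth.clm (ContinuousLinearMap.fst ℝ ℝ (ι → ℝ))).mul
      (hG.comp_clm (ContinuousLinearMap.snd ℝ ℝ (ι → ℝ)))).integrable_comp hξX
      (measurable_fst.mul (hGm.comp measurable_snd))
  · refine hξX.integral_mul_comp hξ (c := c) (fun L ↦ ?_) (G := fun x ↦ _) (D := D)
      (fun x ↦ ?_) hGm hDm hG hD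
    · classical
      have := hξX.isProbabilityMeasure
      have hL : ∀ x : ι → ℝ, L x = ∑ j, x j * L (Pi.single j 1) := by
        intro x
        conv_lhs => rw [← Finset.univ_sum_single x, map_sum]
        refine Finset.sum_congr rfl fun j _ ↦ ?_
        rw [← smul_eq_mul, ← map_smul, ← Pi.single_smul, smul_eq_mul, mul_one]
      have e : L ∘ X = fun ω ↦ ∑ j, X ω j * L (Pi.single j 1) := by
        ext ω; exact hL _
      rw [e, hL c, covariance_fun_sum_right]
      · refine Finset.sum_congr rfl fun j _ ↦ ?_
        rw [covariance_mul_const_right, hc]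
      · exact fun j ↦ (hXg.eval j).memLp_two.mul_const _
      · exact hξX.fst.memLp_two
    · have hx : ∀ j, HasDerivAt (fun s : ℝ ↦ (x + s • c) j) (c j) 0 := by
        intro j
        simpa using ((hasDerivAt_id (0 : ℝ)).mul_const (c j)).const_add (x j)
      have hM := hasDerivAt_wickMass w (a := fun _ ↦ a) (a' := 0)
        (fun j ↦ hasDerivAt_const _ _) hx
      have he := ((hx i).sub_const (a i / 2)).exp
      have := he.mul ((hg _).comp (0 : ℝ) hM)
      refine this.congr_deriv ?_
      simp [D]
      ring

/-- Comparison for finitely many coordinates. -/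
lemma integral_comp_wickMass_le {Ω : Type*} {mΩ : MeasurableSpace Ω} {P : Measure Ω}
    {X Y : Ω → ι → ℝ} (hXY : HasGaussianLaw (fun ω ↦ (X ω, Y ω)) P)
    (hX : ∀ i, ∫ ω, X ω i ∂P = 0) (hY : ∀ i, ∫ ω, Y ω i ∂P = 0)
    (hcov : ∀ i j, cov[fun ω ↦ X ω i, fun ω ↦ Y ω j; P] = 0) {A B : ι → ι → ℝ}
    (hA : ∀ i j, cov[fun ω ↦ X ω i, fun ω ↦ X ω j; P] = A i j)
    (hB : ∀ i j, cov[fun ω ↦ Y ω i, fun ω ↦ Y ω j; P] = B i j)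
    (hAB : ∀ i j, A i j ≤ B i j) {w : ι → ℝ} (hw : ∀ i, 0 ≤ w i)
    {f f' f'' : ℝ → ℝ} (hf : ∀ x, HasDerivAt f (f' x) x) (hf' : ∀ x, HasDerivAt f' (f'' x) x)
    (hf''m : Measurable f'') {C : ℝ} (hC' : ∀ x, |f' x| ≤ C) (hC'' : ∀ x, |f'' x| ≤ C)
    (hf''0 : ∀ x, 0 ≤ f'' x) :
    ∫ ω, f (wickMass w (fun i ↦ A i i) (X ω)) ∂P ≤
      ∫ ω, f (wickMass w (fun i ↦ B i i) (Y ω)) ∂P := by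
  have hP := hXY.isProbabilityMeasure
  have hXm : AEMeasurable X P := hXY.fst.aemeasurable
  have hYm : AEMeasurable Y P := hXY.snd.aemeasurable
  have hX2 : ∀ i, MemLp (fun ω ↦ X ω i) 2 P := fun i ↦ (hXY.fst.eval i).memLp_two
  have hY2 : ∀ i, MemLp (fun ω ↦ Y ω i) 2 P := fun i ↦ (hXY.snd.eval i).memLp_two
  have hcov' : ∀ i j, cov[fun ω ↦ Y ω i, fun ω ↦ X ω j; P] = 0 := fun i j ↦ by
    rw [covariance_comm, hcov]
  have hfc : Continuous f := continuous_iff_continuousAt.2 fun x ↦ (hf x).continuousAt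
  have hf'c : Continuous f' := continuous_iff_continuousAt.2 fun x ↦ (hf' x).continuousAt
  have hfm := hfc.measurable
  have hf'm := hf'c.measurable
  have hC0 : 0 ≤ C := (abs_nonneg _).trans (hC' 0)
  have hlip : ∀ x, |f x| ≤ |f 0| + C * |x| := by
    intro x
    have := Convex.norm_image_sub_le_of_norm_hasDerivWithin_le (f := f) (f' := f') (s := Set.univ)
      (C := C) (x := 0) (y := x) (fun x _ ↦ (hf x).hasDerivWithinAt) (fun x _ ↦ hC' x)
      convex_univ trivial trivial
    simp only [norm_eq_abs, sub_zero] at this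
    have h2 := abs_add_le (f x - f 0) (f 0)
    simp only [sub_add_cancel] at h2
    linarith
  set Z : ℝ → Ω → ι → ℝ := fun θ ω ↦ cos θ • X ω + sin θ • Y ω with hZ
  set Z' : ℝ → Ω → ι → ℝ := fun θ ω ↦ -sin θ • X ω + cos θ • Y ω with hZ'
  set c : ℝ → ι → ℝ := fun θ i ↦ cos θ ^ 2 * A i i + sin θ ^ 2 * B i i with hc
  set γ : ℝ → ι → ι → ℝ := fun θ i j ↦ sin θ * cos θ * (B i j - A i j) with hγ
  have hZd : ∀ θ ω i, HasDerivAt (fun s ↦ Z s ω i) (Z' θ ω i) θ := by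
    intro θ ω i
    simpa [hZ, hZ'] using ((hasDerivAt_cos θ).mul_const (X ω i)).fun_add
      ((hasDerivAt_sin θ).mul_const (Y ω i))
  have hcd : ∀ θ i, HasDerivAt (fun s ↦ c s i) (2 * γ θ i i) θ := by
    intro θ i
    refine ((((hasDerivAt_cos θ).pow 2).mul_const (A i i)).add
      (((hasDerivAt_sin θ).pow 2).mul_const (B i i))).congr_deriv ?_
    simp [hγ]; ring
  have hZZ' : ∀ θ i, HasGaussianLaw (fun ω ↦ (Z' θ ω i, Z θ ω)) P := by
    intro θ i
    have := hXY.map_fun ((((ContinuousLinearMap.proj (R := ℝ) (φ := fun _ : ι ↦ ℝ) i).comp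
      (-sin θ • ContinuousLinearMap.fst ℝ (ι → ℝ) (ι → ℝ) +
        cos θ • ContinuousLinearMap.snd ℝ (ι → ℝ) (ι → ℝ)))).prod
      (cos θ • ContinuousLinearMap.fst ℝ (ι → ℝ) (ι → ℝ) +
        sin θ • ContinuousLinearMap.snd ℝ (ι → ℝ) (ι → ℝ)))
    refine this.congr (Filter.Eventually.of_forall fun ω ↦ ?_)
    simp [hZ, hZ']
  have hmean : ∀ θ i, ∫ ω, Z' θ ω i ∂P = 0 := by
    intro θ i
    simp only [hZ', Pi.add_apply, Pi.smul_apply, smul_eq_mul]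
    rw [integral_add (((hX2 i).integrable one_le_two).const_mul _)
      (((hY2 i).integrable one_le_two).const_mul _), integral_const_mul, integral_const_mul,
      hX, hY]
    simp
  have hZcov : ∀ θ i j, cov[fun ω ↦ Z' θ ω i, fun ω ↦ Z θ ω j; P] = γ θ i j := by
    intro θ i j
    simp only [hZ, hZ', Pi.add_apply, Pi.smul_apply, smul_eq_mul]
    have h1 := covariance_add_left ((hX2 i).const_mul (-sin θ)) ((hY2 i).const_mul (cos θ))
      (((hX2 j).const_mul (cos θ)).add ((hY2 j).const_mul (sin θ)))
    rw [covariance_add_right ((hX2 i).const_mul _) ((hX2 j).const_mul _) ((hY2 j).const_mul _),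
      covariance_add_right ((hY2 i).const_mul _) ((hX2 j).const_mul _) ((hY2 j).const_mul _)] at h1
    refine h1.trans ?_
    simp only [covariance_const_mul_left, covariance_const_mul_right, hA, hB, hcov, hcov', hγ]
    ring
  have ibp := fun θ i ↦ integral_mul_exp_mul_comp_wickMass (hZZ' θ i) (hmean θ i) (hZcov θ i)
    w (c θ) hf' hf''m hC' hC'' i
  set F : ℝ → Ω → ℝ := fun θ ω ↦ f (wickMass w (c θ) (Z θ ω)) with hF
  set F' : ℝ → Ω → ℝ := fun θ ω ↦ f' (wickMass w (c θ) (Z θ ω)) *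
    ∑ i, w i * (exp (Z θ ω i - c θ i / 2) * (Z' θ ω i - 2 * γ θ i i / 2)) with hF'
  have hFd : ∀ θ ω, HasDerivAt (fun s ↦ F s ω) (F' θ ω) θ := by
    intro θ ω
    exact (hf _).comp θ (hasDerivAt_wickMass w (hcd θ) (hZd θ ω))
  have hZm : ∀ θ, AEMeasurable (Z θ) P := fun θ ↦
    (hXm.const_smul (cos θ)).add (hYm.const_smul (sin θ))
  have hFm : ∀ θ, AEStronglyMeasurable (F θ) P := fun θ ↦
    ((hfm.comp (measurable_wickMass w (c θ))).comp_aemeasurable (hZm θ)).aestronglyMeasurable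
  have hFint : ∀ θ, Integrable (F θ) P := by
    intro θ
    obtain ⟨K, hK, hb⟩ := (hasExpGrowth_wickMass w (c θ))
    have hg : HasExpGrowth (fun x ↦ |f 0| + C * |wickMass w (c θ) x|) :=
      (HasExpGrowth.const _).add (HasExpGrowth.const_mul _ ⟨K, hK, by simpa using hb⟩)
    have hm := measurable_wickMass w (c θ)
    rcases isEmpty_or_nonempty ι with hι | ⟨⟨i⟩⟩
    · simp only [hF, wickMass]
      simp
    · exact (hg.integrable_comp (hZZ' θ i).snd (by fun_prop)).mono' (hFm θ)
        (Filter.Eventually.of_forall fun ω ↦ hlip _)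
  set T : ℝ := ∑ i, (|A i i| + |B i i|) with hT
  have hTi : ∀ i, |A i i| + |B i i| ≤ T := fun i ↦
    Finset.single_le_sum (f := fun i ↦ |A i i| + |B i i|) (fun j _ ↦ by positivity)
      (Finset.mem_univ i)
  have hbound : ∀ θ ω, |F' θ ω| ≤
      C * ∑ i, w i * exp (2 * (2 * ‖(X ω, Y ω)‖ + T)) := by
    intro θ ω
    have hs := abs_sin_le_one θ
    have hco := abs_cos_le_one θ
    have hx : ∀ i, |X ω i| ≤ ‖(X ω, Y ω)‖ := fun i ↦
      (norm_le_pi_norm (X ω) i).trans (norm_fst_le (X ω, Y ω))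
    have hy : ∀ i, |Y ω i| ≤ ‖(X ω, Y ω)‖ := fun i ↦
      (norm_le_pi_norm (Y ω) i).trans (norm_snd_le (X ω, Y ω))
    have m1 : ∀ a b : ℝ, |a| ≤ 1 → |a * b| ≤ |b| := fun a b h ↦ by
      rw [abs_mul]; exact mul_le_of_le_one_left (abs_nonneg _) h
    have hz : ∀ i, |Z θ ω i| ≤ 2 * ‖(X ω, Y ω)‖ := by
      intro i
      have := abs_add_le (cos θ * X ω i) (sin θ * Y ω i)
      have h1 := m1 _ (X ω i) hco
      have h2 := m1 _ (Y ω i) hs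
      have : |Z θ ω i| = |cos θ * X ω i + sin θ * Y ω i| := by simp [hZ]
      linarith [hx i, hy i]
    have hz' : ∀ i, |Z' θ ω i| ≤ 2 * ‖(X ω, Y ω)‖ := by
      intro i
      have := abs_add_le (-sin θ * X ω i) (cos θ * Y ω i)
      have h1 := m1 (-sin θ) (X ω i) (by rwa [abs_neg])
      have h2 := m1 _ (Y ω i) hco
      have : |Z' θ ω i| = |-sin θ * X ω i + cos θ * Y ω i| := by simp [hZ']
      linarith [hx i, hy i]
    have hc0 : ∀ i, |c θ i / 2| ≤ T := by
      intro i
      have := abs_add_le (cos θ ^ 2 * A i i) (sin θ ^ 2 * B i i)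
      have h1 := m1 (cos θ ^ 2) (A i i) (by rw [abs_pow]; exact pow_le_one₀ (abs_nonneg _) hco)
      have h2 := m1 (sin θ ^ 2) (B i i) (by rw [abs_pow]; exact pow_le_one₀ (abs_nonneg _) hs)
      have h3 : |c θ i / 2| = |cos θ ^ 2 * A i i + sin θ ^ 2 * B i i| / 2 := by
        rw [abs_div]; simp [hc]
      linarith [hTi i, abs_nonneg (A i i), abs_nonneg (B i i)]
    have hγ0 : ∀ i, |2 * γ θ i i / 2| ≤ T := by
      intro i
      have h1 := m1 (sin θ * cos θ) (B i i - A i i) (by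
        rw [abs_mul]; exact mul_le_one₀ hs (abs_nonneg _) hco)
      have h2 := abs_sub (B i i) (A i i)
      have h3 : 2 * γ θ i i / 2 = sin θ * cos θ * (B i i - A i i) := by simp [hγ]
      rw [h3]
      linarith [hTi i]
    rw [hF', abs_mul]
    refine mul_le_mul (hC' _) ((Finset.abs_sum_le_sum_abs _ _).trans
      (Finset.sum_le_sum fun i _ ↦ ?_)) (abs_nonneg _) hC0
    rw [abs_mul, abs_of_nonneg (hw i), abs_mul, abs_exp, two_mul (2 * _ + T), exp_add]
    refine mul_le_mul_of_nonneg_left (mul_le_mul ?_ ?_ (abs_nonneg _) (exp_pos _).le) (hw i)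
    · refine exp_le_exp.2 ((le_abs_self _).trans ((abs_sub _ _).trans ?_))
      linarith [hz i, hc0 i]
    · refine (abs_sub _ _).trans (le_trans ?_ (add_one_le_exp _))
      linarith [hz' i, hγ0 i]
  have hbint : Integrable (fun ω ↦ C * ∑ i, w i * exp (2 * (2 * ‖(X ω, Y ω)‖ + T))) P := by
    refine (integrable_finsetSum _ fun i _ ↦ Integrable.const_mul ?_ _).const_mul _
    refine ((hXY.integrable_exp_mul_norm 4).const_mul (exp (2 * T))).congr
      (Filter.Eventually.of_forall fun ω ↦ ?_)
    simp only [← exp_add]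
    congr 1; ring
  have hφ : ∀ θ, HasDerivAt (fun s ↦ ∫ ω, F s ω ∂P) (∫ ω, F' θ ω ∂P) θ := by
    intro θ
    refine (hasDerivAt_integral_of_dominated_loc_of_deriv_le (s := Set.univ) Filter.univ_mem
      (Filter.Eventually.of_forall hFm) (hFint θ) ?_
      (Filter.Eventually.of_forall fun ω s _ ↦ hbound s ω) hbint
      (Filter.Eventually.of_forall fun ω s _ ↦ hFd s ω)).2
    have hZm' : AEMeasurable (Z' θ) P := (hXm.const_smul (-sin θ)).add (hYm.const_smul (cos θ))
    have h3 : AEMeasurable (fun ω ↦ f' (wickMass w (c θ) (Z θ ω))) P :=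
      (hf'm.comp (measurable_wickMass w (c θ))).comp_aemeasurable (hZm θ)
    have h4 : ∀ i, AEMeasurable (fun ω ↦ Z θ ω i) P := fun i ↦
      (measurable_pi_apply i).comp_aemeasurable (hZm θ)
    have h5 : ∀ i, AEMeasurable (fun ω ↦ Z' θ ω i) P := fun i ↦
      (measurable_pi_apply i).comp_aemeasurable hZm'
    exact (h3.mul (Finset.aemeasurable_fun_sum _ fun i _ ↦ (((((h4 i).sub_const _).exp).mul
      ((h5 i).sub_const _)).const_mul _))).aestronglyMeasurable
  have hpos : ∀ θ ∈ Set.Ioo 0 (π / 2), 0 ≤ ∫ ω, F' θ ω ∂P := by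
    intro θ hθ
    have hγ0 : ∀ i j, 0 ≤ γ θ i j := fun i j ↦ mul_nonneg (mul_nonneg
      (sin_nonneg_of_nonneg_of_le_pi hθ.1.le (by linarith [hθ.2, pi_pos]))
      (cos_nonneg_of_neg_pi_div_two_le_of_le (by linarith [hθ.1, pi_pos]) hθ.2.le))
      (sub_nonneg.2 (hAB i j))
    have e : ∀ ω, F' θ ω = ∑ i, w i *
        (Z' θ ω i * (exp (Z θ ω i - c θ i / 2) * f' (wickMass w (c θ) (Z θ ω))) -
          γ θ i i * (exp (Z θ ω i - c θ i / 2) * f' (wickMass w (c θ) (Z θ ω)))) := by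
      intro ω
      simp only [hF', Finset.mul_sum]
      refine Finset.sum_congr rfl fun i _ ↦ by ring
    simp_rw [e]
    have hi := fun i ↦ ((ibp θ i).2.1.sub ((ibp θ i).1.const_mul (γ θ i i))).const_mul (w i)
    refine (integral_finsetSum Finset.univ fun i _ ↦ hi i).symm.le.trans' ?_
    simp only [Pi.sub_apply]
    refine Finset.sum_nonneg fun i _ ↦ ?_
    rw [integral_const_mul, integral_sub (ibp θ i).2.1 ((ibp θ i).1.const_mul _),
      (ibp θ i).2.2.2, ← integral_sub (ibp θ i).2.2.1 ((ibp θ i).1.const_mul _)]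
    refine mul_nonneg (hw i) (integral_nonneg fun ω ↦ ?_)
    simp only [Pi.zero_apply, add_sub_cancel_left]
    exact mul_nonneg (exp_pos _).le (mul_nonneg (hf''0 _) (Finset.sum_nonneg fun j _ ↦
      mul_nonneg (hw j) (mul_nonneg (exp_pos _).le (hγ0 i j))))
  have hmono : MonotoneOn (fun θ ↦ ∫ ω, F θ ω ∂P) (Set.Icc 0 (π / 2)) := by
    refine monotoneOn_of_deriv_nonneg (convex_Icc _ _)
      (fun θ _ ↦ (hφ θ).continuousAt.continuousWithinAt)
      (fun θ _ ↦ (hφ θ).differentiableAt.differentiableWithinAt) fun θ hθ ↦ ?_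
    rw [(hφ θ).deriv]
    exact hpos θ (by simpa using hθ)
  have := hmono (Set.left_mem_Icc.2 (by positivity)) (Set.right_mem_Icc.2 (by positivity))
    (by positivity)
  simpa [hF, hZ, hc] using this

end Discrete

namespace IsContGaussianField

variable {Ω : Type*} [MeasureSpace Ω] {K : Set (EuclideanSpace ℝ (Fin 2))}
  {Γ : Ω → EuclideanSpace ℝ (Fin 2) → ℝ}
  {C : EuclideanSpace ℝ (Fin 2) → EuclideanSpace ℝ (Fin 2) → ℝ}
  {z w : EuclideanSpace ℝ (Fin 2)}

lemma measurable_apply (h : IsContGaussianField K Γ C) (z : EuclideanSpace ℝ (Fin 2)) :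
    Measurable (fun ω ↦ Γ ω z) :=
  h.1.comp measurable_prodMk_right

lemma exists_map_sum_eq (h : IsContGaussianField K Γ C) {ι : Type*} [Fintype ι] (a : ι → ℝ)
    {z : ι → EuclideanSpace ℝ (Fin 2)} (hz : ∀ i, z i ∈ K) :
    ∃ v : ℝ≥0, (ℙ : Measure Ω).map (fun ω ↦ ∑ i, a i * Γ ω (z i)) = gaussianReal 0 v := by
  let e := Fintype.equivFin ι
  obtain ⟨v, hv⟩ := h.2.2.1 _ (a ∘ e.symm) (z ∘ e.symm) fun _ ↦ hz _
  refine ⟨v, ?_⟩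
  rw [← hv]
  congr 1 with ω
  exact (Equiv.sum_comp e.symm fun i ↦ a i * Γ ω (z i)).symm

/-- The values of a Gaussian field at finitely many points form a Gaussian vector. -/
lemma hasGaussianLaw (h : IsContGaussianField K Γ C) {ι : Type*} [Fintype ι]
    {z : ι → EuclideanSpace ℝ (Fin 2)} (hz : ∀ i, z i ∈ K) :
    HasGaussianLaw (fun ω i ↦ Γ ω (z i)) (ℙ : Measure Ω) where
  isGaussian_map := isGaussian_of_map_eq_gaussianReal fun L ↦ by
    classical
    obtain ⟨v, hv⟩ := h.exists_map_sum_eq (fun i ↦ L (Pi.single i 1)) hz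
    refine ⟨0, v, ?_⟩
    rw [Measure.map_map L.measurable (measurable_pi_lambda _ fun i ↦ h.measurable_apply _), ← hv]
    congr 1 with ω
    rw [Function.comp_apply, ← Finset.univ_sum_single (fun i ↦ Γ ω (z i)), map_sum]
    refine Finset.sum_congr rfl fun i _ ↦ ?_
    rw [mul_comm, ← smul_eq_mul, ← map_smul, ← Pi.single_smul, smul_eq_mul, mul_one]

lemma covariance_self_nonneg (h : IsContGaussianField K Γ C) (hz : z ∈ K) : 0 ≤ C z z := by
  rw [h.2.2.2.1 z hz z hz]
  exact integral_nonneg fun ω ↦ mul_self_nonneg _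

lemma map_eq_gaussianReal (h : IsContGaussianField K Γ C) (hz : z ∈ K) :
    (ℙ : Measure Ω).map (fun ω ↦ Γ ω z) = gaussianReal 0 (C z z).toNNReal := by
  obtain ⟨v, hv⟩ := h.2.2.1 1 (fun _ ↦ 1) (fun _ ↦ z) fun _ ↦ hz
  simp only [one_mul, Finset.univ_unique, Finset.sum_singleton] at hv
  have h2 : ∫ x, x * x ∂(gaussianReal 0 v) = v := by
    have := variance_fun_id_gaussianReal (μ := 0) (v := v)
    rw [variance_eq_integral (by fun_prop)] at this
    simpa [integral_id_gaussianReal, sq] using this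
  rw [hv, h.2.2.2.1 z hz z hz, ← integral_map (φ := fun ω ↦ Γ ω z) (f := fun x ↦ x * x)
    (h.measurable_apply z).aemeasurable (by fun_prop), hv, h2, toNNReal_coe]

lemma integral_eq_zero (h : IsContGaussianField K Γ C) (hz : z ∈ K) :
    ∫ ω, Γ ω z = 0 := by
  rw [← integral_map (φ := fun ω ↦ Γ ω z) (f := fun x ↦ x)
    (h.measurable_apply z).aemeasurable (by fun_prop), h.map_eq_gaussianReal hz,
    integral_id_gaussianReal]

lemma memLp_two (h : IsContGaussianField K Γ C) (hz : z ∈ K) :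
    MemLp (fun ω ↦ Γ ω z) 2 (ℙ : Measure Ω) :=
  ((h.hasGaussianLaw (ι := Unit) fun _ ↦ hz).eval ()).memLp_two

lemma covariance_eq [IsProbabilityMeasure (ℙ : Measure Ω)] (h : IsContGaussianField K Γ C)
    (hz : z ∈ K) (hw : w ∈ K) : cov[fun ω ↦ Γ ω z, fun ω ↦ Γ ω w; ℙ] = C z w := by
  rw [covariance_eq_sub (h.memLp_two hz) (h.memLp_two hw), h.integral_eq_zero hz,
    h.2.2.2.1 z hz w hw]
  simp

lemma integrable_exp_pow (h : IsContGaussianField K Γ C) (hz : z ∈ K) (p : ℕ) :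
    Integrable (fun ω ↦ exp (Γ ω z - C z z / 2) ^ p) := by
  have := (integrable_exp_mul_gaussianReal (μ := 0) (v := (C z z).toNNReal) p)
  rw [← h.map_eq_gaussianReal hz, integrable_map_measure (by fun_prop)
    (h.measurable_apply z).aemeasurable] at this
  refine (this.mul_const (exp (p * (- (C z z / 2))))).congr (.of_forall fun ω ↦ ?_)
  simp only [Function.comp_apply]
  rw [← exp_nat_mul, ← exp_add]
  ring_nf

lemma integral_exp_pow (h : IsContGaussianField K Γ C) (hz : z ∈ K) (p : ℕ) :
    ∫ ω, exp (Γ ω z - C z z / 2) ^ p = exp ((p ^ 2 - p) / 2 * C z z) := by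
  have := mgf_gaussianReal (h.map_eq_gaussianReal hz) p
  rw [mgf, coe_toNNReal _ (h.covariance_self_nonneg hz)] at this
  have e : ∀ ω, exp (Γ ω z - C z z / 2) ^ p = exp (p * (- (C z z / 2))) * exp (p * Γ ω z) := by
    intro ω
    rw [← exp_nat_mul, ← exp_add]
    ring_nf
  simp_rw [e]
  rw [integral_const_mul, this, ← exp_add]
  ring_nf

lemma integral_exp (h : IsContGaussianField K Γ C) (hz : z ∈ K) :
    ∫ ω, exp (Γ ω z - C z z / 2) = 1 := by
  simpa using h.integral_exp_pow hz 1

lemma continuousOn_covariance_self (h : IsContGaussianField K Γ C) :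
    ContinuousOn (fun z ↦ C z z) K :=
  h.2.2.2.2.comp (f := fun z ↦ (z, z)) (by fun_prop) fun _ hz ↦ ⟨hz, hz⟩

lemma ae_continuousOn_exp (h : IsContGaussianField K Γ C) :
    ∀ᵐ ω, ContinuousOn (fun z ↦ exp (Γ ω z - C z z / 2)) K := by
  filter_upwards [h.2.1] with ω hω
  exact (hω.sub (h.continuousOn_covariance_self.div_const 2)).rexp

lemma aestronglyMeasurable_exp (h : IsContGaussianField K Γ C) (hK : IsCompact K) :
    AEStronglyMeasurable (fun q : Ω × EuclideanSpace ℝ (Fin 2) ↦ exp (Γ q.1 q.2 - C q.2 q.2 / 2))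
      ((ℙ : Measure Ω).prod (volume.restrict K)) := by
  have h1 := h.continuousOn_covariance_self.aestronglyMeasurable (μ := volume) hK.measurableSet
  have h2 : AEMeasurable (fun q : Ω × EuclideanSpace ℝ (Fin 2) ↦ C q.2 q.2)
      ((ℙ : Measure Ω).prod (volume.restrict K)) := h1.comp_snd.aemeasurable
  have h3 : AEMeasurable (fun q : Ω × EuclideanSpace ℝ (Fin 2) ↦ Γ q.1 q.2)
      ((ℙ : Measure Ω).prod (volume.restrict K)) := h.1.aemeasurable
  exact (h3.sub (h2.div_const 2)).exp.aestronglyMeasurable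

lemma aestronglyMeasurable_mass (h : IsContGaussianField K Γ C) (hK : IsCompact K) :
    AEStronglyMeasurable (fun ω ↦ ∫ z in K, exp (Γ ω z - C z z / 2)) ℙ := by
  have : IsFiniteMeasure (volume.restrict K) := ⟨by simpa using hK.measure_lt_top⟩
  exact (h.aestronglyMeasurable_exp hK).integral_prod_right'

lemma ae_mass_pos (h : IsContGaussianField K Γ C) (hK : IsCompact K) (hKpos : 0 < volume K) :
    ∀ᵐ ω, 0 < ∫ z in K, exp (Γ ω z - C z z / 2) := by
  have : NeZero (volume.restrict K) := ⟨by simpa using hKpos.ne'⟩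
  filter_upwards [h.ae_continuousOn_exp] with ω hω
  exact integral_exp_pos (hω.integrableOn_compact hK)

variable [IsProbabilityMeasure (ℙ : Measure Ω)]

lemma integrable_prod_exp_pow (h : IsContGaussianField K Γ C) (hK : IsCompact K) (p : ℕ) :
    Integrable (fun q : Ω × EuclideanSpace ℝ (Fin 2) ↦ exp (Γ q.1 q.2 - C q.2 q.2 / 2) ^ p)
      ((ℙ : Measure Ω).prod (volume.restrict K)) := by
  have : IsFiniteMeasure (volume.restrict K) := ⟨by simpa using hK.measure_lt_top⟩
  refine (integrable_prod_iff' ((h.aestronglyMeasurable_exp hK).pow p)).2 ?_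
  constructor
  · filter_upwards [ae_restrict_mem hK.measurableSet] with z hz
    exact h.integrable_exp_pow hz p
  · have : ContinuousOn (fun z ↦ exp (((p : ℝ) ^ 2 - p) / 2 * C z z)) K :=
      (continuousOn_const.mul h.continuousOn_covariance_self).rexp
    refine (this.integrableOn_compact hK).congr ?_
    filter_upwards [ae_restrict_mem hK.measurableSet] with z hz
    simp only [Pi.pow_apply, norm_pow, norm_eq_abs, abs_exp]
    exact (h.integral_exp_pow hz p).symm

lemma integrable_prod_exp (h : IsContGaussianField K Γ C) (hK : IsCompact K) :
    Integrable (fun q : Ω × EuclideanSpace ℝ (Fin 2) ↦ exp (Γ q.1 q.2 - C q.2 q.2 / 2))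
      ((ℙ : Measure Ω).prod (volume.restrict K)) := by
  simpa using h.integrable_prod_exp_pow hK 1

/-- The total mass has finite moments of all orders. -/
lemma integrable_mass_pow (h : IsContGaussianField K Γ C) (hK : IsCompact K)
    (hKpos : 0 < volume K) (p : ℕ) :
    Integrable (fun ω ↦ (∫ z in K, exp (Γ ω z - C z z / 2)) ^ p) := by
  have : IsFiniteMeasure (volume.restrict K) := ⟨by simpa using hK.measure_lt_top⟩
  have : NeZero (volume.restrict K) := ⟨by simpa using hKpos.ne'⟩
  set V : ℝ := (volume.restrict K).real Set.univ with hV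
  have hV0 : 0 < V := by
    rw [hV, measureReal_def, ENNReal.toReal_pos_iff]
    simpa using ⟨hKpos, hK.measure_lt_top⟩
  refine ((h.integrable_prod_exp_pow hK p).integral_prod_left.const_mul (V ^ p * V⁻¹)).mono'
    ((h.aestronglyMeasurable_mass hK).pow p) ?_
  filter_upwards [h.ae_continuousOn_exp] with ω hω
  have hJ := (convexOn_pow p).map_average_le (μ := volume.restrict K) (continuousOn_pow p)
    isClosed_Ici (f := fun z ↦ exp (Γ ω z - C z z / 2)) (.of_forall fun z ↦ (exp_pos _).le)
    (hω.integrableOn_compact hK) ((hω.pow p).integrableOn_compact hK)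
  rw [average_eq, average_eq, smul_eq_mul, smul_eq_mul, mul_pow, ← hV] at hJ
  have hM : 0 ≤ ∫ z in K, exp (Γ ω z - C z z / 2) := integral_nonneg fun z ↦ (exp_pos _).le
  rw [norm_eq_abs, abs_of_nonneg (pow_nonneg hM p)]
  calc (∫ z in K, exp (Γ ω z - C z z / 2)) ^ p
      = V ^ p * (V⁻¹ ^ p * (∫ z in K, exp (Γ ω z - C z z / 2)) ^ p) := by
        rw [← mul_assoc, ← mul_pow, mul_inv_cancel₀ hV0.ne', one_pow, one_mul]
    _ ≤ V ^ p * (V⁻¹ * ∫ z in K, exp (Γ ω z - C z z / 2) ^ p) := by gcongr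
    _ = _ := by ring

/-- Approximating the points of `K` by points of `K` approximates the total mass in `L¹`. -/
lemma tendsto_integral_comp_mass (h : IsContGaussianField K Γ C) (hK : IsCompact K)
    {s : ℕ → SimpleFunc (EuclideanSpace ℝ (Fin 2)) (EuclideanSpace ℝ (Fin 2))}
    (hs : ∀ n z, s n z ∈ K)
    (hlim : ∀ z ∈ K, Filter.Tendsto (fun n ↦ s n z) Filter.atTop (nhds z))
    {f : ℝ → ℝ} {L : ℝ≥0} (hf : LipschitzWith L f) :
    Filter.Tendsto (fun n ↦ ∫ ω, f (∫ z in K, exp (Γ ω (s n z) - C (s n z) (s n z) / 2)))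
      Filter.atTop (nhds (∫ ω, f (∫ z in K, exp (Γ ω z - C z z / 2)))) := by
  have : IsFiniteMeasure (volume.restrict K) := ⟨by simpa using hK.measure_lt_top⟩
  set μ := (ℙ : Measure Ω).prod (volume.restrict K) with hμ
  set g : Ω × EuclideanSpace ℝ (Fin 2) → ℝ := fun q ↦ exp (Γ q.1 q.2 - C q.2 q.2 / 2) with hg
  set G : ℕ → Ω × EuclideanSpace ℝ (Fin 2) → ℝ := fun n q ↦
    exp (Γ q.1 (s n q.2) - C (s n q.2) (s n q.2) / 2) with hG
  have hgi : Integrable g μ := h.integrable_prod_exp hK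
  have hGm : ∀ n, Measurable (G n) := fun n ↦ by
    have h1 : Measurable (fun q : Ω × EuclideanSpace ℝ (Fin 2) ↦ Γ q.1 (s n q.2)) :=
      h.1.comp (measurable_fst.prodMk ((s n).measurable.comp measurable_snd))
    have h2 := ((s n).map fun y ↦ C y y).measurable
    exact (h1.sub ((h2.comp measurable_snd).div_const 2)).exp
  have hGi : ∀ n, Integrable (G n) μ := fun n ↦ by
    rw [hμ, integrable_prod_iff' (hGm n).aestronglyMeasurable]
    refine ⟨.of_forall fun z ↦ by simpa [hG] using h.integrable_exp_pow (hs n z) 1, ?_⟩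
    simp [hG, h.integral_exp (hs n _)]
  have hint : ∀ n, ∫ q, g q - G n q ∂μ = 0 := fun n ↦ by
    rw [integral_sub hgi (hGi n), hμ, integral_prod_symm _ hgi, integral_prod_symm _ (hGi n),
      setIntegral_congr_fun hK.measurableSet fun z hz ↦ h.integral_exp hz]
    simp [hG, h.integral_exp (hs n _)]
  have hpos : Filter.Tendsto (fun n ↦ ∫ q, max (g q - G n q) 0 ∂μ) Filter.atTop (nhds 0) := by
    have : Filter.Tendsto (fun n ↦ ∫ q, max (g q - G n q) 0 ∂μ) Filter.atTop
        (nhds (∫ q, (0 : ℝ) ∂μ)) := by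
      refine tendsto_integral_of_dominated_convergence g
        (fun n ↦ ((hgi.sub (hGi n)).pos_part).aestronglyMeasurable) hgi
        (fun n ↦ .of_forall fun q ↦ ?_) ?_
      · rw [norm_eq_abs, abs_of_nonneg (le_max_right _ _)]
        exact max_le (sub_le_self _ (exp_pos _).le) (exp_pos _).le
      · have h1 : ∀ᵐ q ∂μ, ContinuousOn (fun z ↦ exp (Γ q.1 z - C z z / 2)) K :=
          Measure.quasiMeasurePreserving_fst.ae h.ae_continuousOn_exp
        have h2 : ∀ᵐ q ∂μ, q.2 ∈ K :=
          Measure.quasiMeasurePreserving_snd.ae (ae_restrict_mem hK.measurableSet)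
        filter_upwards [h1, h2] with q hq hqK
        have : Filter.Tendsto (fun n ↦ G n q) Filter.atTop (nhds (g q)) :=
          (hq q.2 hqK).tendsto.comp (tendsto_nhdsWithin_iff.2
            ⟨hlim q.2 hqK, .of_forall fun n ↦ hs n q.2⟩)
        simpa using ((tendsto_const_nhds (x := g q)).sub this).max
          (tendsto_const_nhds (x := (0 : ℝ)))
    simpa using this
  have habs : ∀ n, ∫ q, |G n q - g q| ∂μ = 2 * ∫ q, max (g q - G n q) 0 ∂μ := fun n ↦ by
    have e : ∀ q, |G n q - g q| = 2 * max (g q - G n q) 0 - (g q - G n q) := fun q ↦ by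
      rw [abs_sub_comm]
      rcases le_total (g q - G n q) 0 with h0 | h0
      · rw [abs_of_nonpos h0, max_eq_right h0]; ring
      · rw [abs_of_nonneg h0, max_eq_left h0]; ring
    simp_rw [e]
    have h1 : Integrable (fun q ↦ 2 * max (g q - G n q) 0) μ :=
      ((hgi.sub (hGi n)).pos_part).const_mul 2
    have h2 : Integrable (fun q ↦ g q - G n q) μ := hgi.sub (hGi n)
    rw [integral_sub h1 h2, hint, integral_const_mul, sub_zero]
  have hlipint : ∀ {u : Ω → ℝ}, Integrable u → Integrable fun ω ↦ f (u ω) := fun {u} hu ↦ by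
    refine ((integrable_const |f 0|).add (hu.norm.const_mul L)).mono'
      (hf.continuous.comp_aestronglyMeasurable hu.1) (.of_forall fun ω ↦ ?_)
    have h1 := hf.dist_le_mul (u ω) 0
    rw [dist_eq_norm, dist_zero_right] at h1
    have h2 := norm_add_le (f (u ω) - f 0) (f 0)
    rw [sub_add_cancel] at h2
    simp only [Pi.add_apply, norm_eq_abs] at h1 h2 ⊢
    linarith
  have hm : Integrable (fun ω ↦ ∫ z in K, g (ω, z)) := hgi.integral_prod_left
  have hMn : ∀ n, Integrable (fun ω ↦ ∫ z in K, G n (ω, z)) := fun n ↦ (hGi n).integral_prod_left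
  rw [tendsto_iff_norm_sub_tendsto_zero]
  have hlim2 : Filter.Tendsto (fun n ↦ L * ∫ q, |G n q - g q| ∂μ) Filter.atTop (nhds 0) := by
    simp_rw [habs]
    simpa using (hpos.const_mul 2).const_mul (L : ℝ)
  refine squeeze_zero (fun _ ↦ norm_nonneg _) (fun n ↦ ?_) hlim2
  have hd : Integrable (fun q ↦ |G n q - g q|) μ := ((hGi n).sub hgi).abs
  rw [← integral_sub (hlipint (hMn n)) (hlipint hm), hμ, integral_prod _ hd, ← integral_const_mul]
  refine norm_integral_le_of_norm_le (hd.integral_prod_left.const_mul _) ?_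
  filter_upwards [(hGi n).prod_right_ae, hgi.prod_right_ae] with ω h1 h2
  rw [← dist_eq_norm]
  refine (hf.dist_le_mul _ _).trans (mul_le_mul_of_nonneg_left ?_ L.2)
  rw [dist_eq_norm, ← integral_sub h1 h2]
  exact norm_integral_le_integral_norm _

end IsContGaussianField

lemma MeasureTheory.SimpleFunc.integral_comp_eq_sum {α β : Type*} [MeasurableSpace α]
    {ν : Measure α} [IsFiniteMeasure ν] (s : SimpleFunc α β) (g : β → ℝ) :
    ∫ z, g (s z) ∂ν = ∑ y : s.range, ν.real (s ⁻¹' {y.1}) * g y := by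
  classical
  have e : ∀ z, g (s z) = ∑ y ∈ s.range, (s ⁻¹' {y}).indicator (fun _ ↦ g y) z := fun z ↦ by
    rw [Finset.sum_eq_single (s z)]
    · simp
    · intro b _ hb
      simp [hb.symm]
    · exact fun h ↦ (h (s.mem_range_self z)).elim
  simp_rw [e]
  rw [integral_finsetSum _ fun y _ ↦ (integrable_const _).indicator (s.measurableSet_preimage _),
    ← Finset.sum_coe_sort]
  refine Finset.sum_congr rfl fun y _ ↦ ?_
  rw [integral_indicator_const _ (s.measurableSet_preimage _), smul_eq_mul]

section Comparison

variable {Ω : Type*} [MeasureSpace Ω] [IsProbabilityMeasure (ℙ : Measure Ω)]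
  {K : Set (EuclideanSpace ℝ (Fin 2))} {Γ₁ Γ₂ : Ω → EuclideanSpace ℝ (Fin 2) → ℝ}
  {C₁ C₂ : EuclideanSpace ℝ (Fin 2) → EuclideanSpace ℝ (Fin 2) → ℝ}

/-- Comparison for discretized masses and smooth convex functions. -/
lemma integral_comp_simpleFunc_mass_le (hK : IsCompact K)
    (h₁ : IsContGaussianField K Γ₁ C₁) (h₂ : IsContGaussianField K Γ₂ C₂)
    (hle : ∀ z ∈ K, ∀ w ∈ K, C₁ z w ≤ C₂ z w)
    {s : SimpleFunc (EuclideanSpace ℝ (Fin 2)) (EuclideanSpace ℝ (Fin 2))} (hs : ∀ z, s z ∈ K)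
    {f f' f'' : ℝ → ℝ} (hf : ∀ x, HasDerivAt f (f' x) x) (hf' : ∀ x, HasDerivAt f' (f'' x) x)
    (hf''m : Measurable f'') {C : ℝ} (hC' : ∀ x, |f' x| ≤ C) (hC'' : ∀ x, |f'' x| ≤ C)
    (hf''0 : ∀ x, 0 ≤ f'' x) :
    ∫ ω, f (∫ z in K, exp (Γ₁ ω (s z) - C₁ (s z) (s z) / 2)) ≤
      ∫ ω, f (∫ z in K, exp (Γ₂ ω (s z) - C₂ (s z) (s z) / 2)) := by
  have : IsFiniteMeasure (volume.restrict K) := ⟨by simpa using hK.measure_lt_top⟩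
  set P := (ℙ : Measure Ω).prod (ℙ : Measure Ω) with hP
  have hr : ∀ y : s.range, y.1 ∈ K := fun ⟨y, hy⟩ ↦ by
    obtain ⟨z, rfl⟩ := SimpleFunc.mem_range.1 hy
    exact hs z
  have hfst : MeasurePreserving Prod.fst P (ℙ : Measure Ω) := measurePreserving_fst
  have hsnd : MeasurePreserving Prod.snd P (ℙ : Measure Ω) := measurePreserving_snd
  have hm₁ : Measurable fun ω (y : s.range) ↦ Γ₁ ω y :=
    measurable_pi_lambda _ fun y ↦ h₁.measurable_apply _
  have hm₂ : Measurable fun ω (y : s.range) ↦ Γ₂ ω y :=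
    measurable_pi_lambda _ fun y ↦ h₂.measurable_apply _
  have hX : HasGaussianLaw (fun (q : Ω × Ω) (y : s.range) ↦ Γ₁ q.1 y) P := ⟨by
    have := (h₁.hasGaussianLaw hr).isGaussian_map
    rwa [← hfst.map_eq, Measure.map_map hm₁ measurable_fst] at this⟩
  have hY : HasGaussianLaw (fun (q : Ω × Ω) (y : s.range) ↦ Γ₂ q.2 y) P := ⟨by
    have := (h₂.hasGaussianLaw hr).isGaussian_map
    rwa [← hsnd.map_eq, Measure.map_map hm₂ measurable_snd] at this⟩
  have hint₁ : ∀ F : Ω → ℝ, ∫ q, F q.1 ∂P = ∫ ω, F ω := fun F ↦ by simp [hP, integral_fun_fst]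
  have hint₂ : ∀ F : Ω → ℝ, ∫ q, F q.2 ∂P = ∫ ω, F ω := fun F ↦ by simp [hP, integral_fun_snd]
  have hmean₁ : ∀ y : s.range, ∫ q, Γ₁ q.1 y ∂P = 0 := fun y ↦
    (hint₁ fun ω ↦ Γ₁ ω y).trans (h₁.integral_eq_zero (hr y))
  have hmean₂ : ∀ y : s.range, ∫ q, Γ₂ q.2 y ∂P = 0 := fun y ↦
    (hint₂ fun ω ↦ Γ₂ ω y).trans (h₂.integral_eq_zero (hr y))
  have hcov₁ : ∀ y y' : s.range, cov[fun q ↦ Γ₁ q.1 y, fun q ↦ Γ₁ q.1 y'; P] = C₁ y y' := by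
    intro y y'
    rw [← h₁.covariance_eq (hr y) (hr y'), covariance, covariance, hmean₁, hmean₁,
      h₁.integral_eq_zero (hr y), h₁.integral_eq_zero (hr y')]
    exact hint₁ fun ω ↦ (Γ₁ ω y - 0) * (Γ₁ ω y' - 0)
  have hcov₂ : ∀ y y' : s.range, cov[fun q ↦ Γ₂ q.2 y, fun q ↦ Γ₂ q.2 y'; P] = C₂ y y' := by
    intro y y'
    rw [← h₂.covariance_eq (hr y) (hr y'), covariance, covariance, hmean₂, hmean₂,
      h₂.integral_eq_zero (hr y), h₂.integral_eq_zero (hr y')]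
    exact hint₂ fun ω ↦ (Γ₂ ω y - 0) * (Γ₂ ω y' - 0)
  have hcov : ∀ y y' : s.range, cov[fun q ↦ Γ₁ q.1 y, fun q ↦ Γ₂ q.2 y'; P] = 0 := fun y y' ↦
    covariance_fst_snd_prod (h₁.memLp_two (hr y)) (h₂.memLp_two (hr y'))
  have hXY : HasGaussianLaw
      (fun q : Ω × Ω ↦ ((fun y : s.range ↦ Γ₁ q.1 y), (fun y : s.range ↦ Γ₂ q.2 y))) P :=
    IndepFun.hasGaussianLaw hX hY (indepFun_prod hm₁ hm₂)
  have key := integral_comp_wickMass_le hXY hmean₁ hmean₂ hcov hcov₁ hcov₂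
    (fun y y' ↦ hle _ (hr y) _ (hr y'))
    (w := fun y ↦ (volume.restrict K).real (s ⁻¹' {y.1})) (fun _ ↦ measureReal_nonneg)
    hf hf' hf''m hC' hC'' hf''0
  simp only [wickMass] at key
  rw [hint₁ fun ω ↦ f (∑ y : s.range, (volume.restrict K).real (s ⁻¹' {y.1}) *
      exp (Γ₁ ω y - C₁ y y / 2)),
    hint₂ fun ω ↦ f (∑ y : s.range, (volume.restrict K).real (s ⁻¹' {y.1}) *
      exp (Γ₂ ω y - C₂ y y / 2))] at key
  have e₁ := fun ω ↦ s.integral_comp_eq_sum (ν := volume.restrict K) fun y ↦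
    exp (Γ₁ ω y - C₁ y y / 2)
  have e₂ := fun ω ↦ s.integral_comp_eq_sum (ν := volume.restrict K) fun y ↦
    exp (Γ₂ ω y - C₂ y y / 2)
  simpa only [e₁, e₂] using key

/-- Comparison for smooth convex functions with bounded derivatives. -/
lemma integral_comp_mass_le_of_hasDerivAt (hK : IsCompact K)
    (h₁ : IsContGaussianField K Γ₁ C₁) (h₂ : IsContGaussianField K Γ₂ C₂)
    (hle : ∀ z ∈ K, ∀ w ∈ K, C₁ z w ≤ C₂ z w) (hne : K.Nonempty)
    {f f' f'' : ℝ → ℝ} (hf : ∀ x, HasDerivAt f (f' x) x) (hf' : ∀ x, HasDerivAt f' (f'' x) x)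
    (hf''m : Measurable f'') {C : ℝ} (hC' : ∀ x, |f' x| ≤ C) (hC'' : ∀ x, |f'' x| ≤ C)
    (hf''0 : ∀ x, 0 ≤ f'' x) :
    ∫ ω, f (∫ z in K, exp (Γ₁ ω z - C₁ z z / 2)) ≤
      ∫ ω, f (∫ z in K, exp (Γ₂ ω z - C₂ z z / 2)) := by
  obtain ⟨z₀, hz₀⟩ := hne
  have hlip : LipschitzWith C.toNNReal f :=
    lipschitzWith_of_nnnorm_deriv_le (fun x ↦ (hf x).differentiableAt) fun x ↦ by
      rw [(hf x).deriv, ← NNReal.coe_le_coe, coe_nnnorm, norm_eq_abs]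
      exact (hC' x).trans (le_coe_toNNReal C)
  let s := SimpleFunc.approxOn id measurable_id K z₀ hz₀
  have hs : ∀ n z, s n z ∈ K := SimpleFunc.approxOn_mem measurable_id hz₀
  have hlim : ∀ z ∈ K, Filter.Tendsto (fun n ↦ s n z) Filter.atTop (nhds z) := fun z hz ↦
    SimpleFunc.tendsto_approxOn measurable_id hz₀ (subset_closure hz)
  exact le_of_tendsto_of_tendsto' (h₁.tendsto_integral_comp_mass hK hs hlim hlip)
    (h₂.tendsto_integral_comp_mass hK hs hlim hlip) fun n ↦
    integral_comp_simpleFunc_mass_le hK h₁ h₂ hle (hs n) hf hf' hf''m hC' hC'' hf''0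

end Comparison

section Convex

open Filter Topology

/-- A convex function on `[0, ∞)` has a supporting line at every positive point, whose slope is at
least that of the chord from `0`. -/
lemma ConvexOn.exists_supporting_slope {f : ℝ → ℝ} (hf : ConvexOn ℝ (Set.Ici 0) f) {q : ℝ}
    (hq : 0 < q) :
    ∃ d, (∀ y, 0 ≤ y → f q + d * (y - q) ≤ f y) ∧ (f q - f 0) / q ≤ d := by
  have hqi : q ∈ interior (Set.Ici (0 : ℝ)) := by simpa using hq
  have hbdd := bddAbove_slope_gt_of_mem_interior hf hqi
  have hleft : ∀ y, 0 ≤ y → y < q → slope f q y ≤ sSup (slope f q '' {y ∈ Set.Ici 0 | y < q}) :=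
    fun y hy hyq ↦ le_csSup hbdd ⟨y, ⟨hy, hyq⟩, rfl⟩
  refine ⟨sSup (slope f q '' {y ∈ Set.Ici 0 | y < q}), fun y hy ↦ ?_, ?_⟩
  · rcases lt_trichotomy y q with h | rfl | h
    · have := hleft y hy h
      rw [slope_def_field, div_le_iff_of_neg (by linarith)] at this
      linarith
    · simp
    · have : sSup (slope f q '' {y ∈ Set.Ici 0 | y < q}) ≤ slope f q y := by
        refine csSup_le ⟨_, 0, ⟨Set.self_mem_Ici, hq⟩, rfl⟩ ?_
        rintro _ ⟨x, ⟨hx, hxq⟩, rfl⟩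
        exact slope_mono hf hq.le ⟨hx, hxq.ne⟩ ⟨hy, h.ne'⟩ (hxq.trans h).le
      rw [slope_def_field, le_div_iff₀ (by linarith)] at this
      linarith
  · have := hleft 0 le_rfl hq
    rw [slope_def_field] at this
    convert this using 1
    rw [← neg_div_neg_eq]
    ring

/-- On `(0, ∞)`, a convex function on `[0, ∞)` is the increasing limit of maxima of finitely many
affine functions. -/
lemma ConvexOn.exists_tendsto_sup'_affine {f : ℝ → ℝ} (hf : ConvexOn ℝ (Set.Ici 0) f) :
    ∃ a b : ℕ → ℝ, (∀ i x, 0 ≤ x → a i * x + b i ≤ f x) ∧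
      ∀ x, 0 < x → Tendsto (fun n ↦ (Finset.range (n + 1)).sup' Finset.nonempty_range_add_one
        fun i ↦ a i * x + b i) atTop (𝓝 (f x)) := by
  have : Nonempty (Set.Ioi (0 : ℝ)) := ⟨⟨1, Set.mem_Ioi.2 one_pos⟩⟩
  let q := TopologicalSpace.denseSeq (Set.Ioi (0 : ℝ))
  choose d hd hd₀ using fun i ↦ hf.exists_supporting_slope (q i).2
  have hle : ∀ i x, 0 ≤ x → d i * x + (f (q i) - d i * q i) ≤ f x := fun i x hx ↦ by
    linarith [hd i x hx]
  refine ⟨d, fun i ↦ f (q i) - d i * q i, hle, fun x hx ↦ ?_⟩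
  refine tendsto_order.2 ⟨fun y hy ↦ ?_, fun y hy ↦ Eventually.of_forall fun n ↦ ?_⟩
  · have hcont : ContinuousAt f x :=
      (hf.continuousOn_interior x (by simpa using hx)).continuousAt
        (isOpen_interior.mem_nhds (by simpa using hx))
    have hlim : Tendsto (fun t ↦ f t + (f t - f 0) / t * (x - t)) (𝓝 x) (𝓝 (f x)) := by
      have : ContinuousAt (fun t ↦ f t + (f t - f 0) / t * (x - t)) x := by
        refine hcont.add (ContinuousAt.mul ?_ (by fun_prop))
        exact (hcont.sub continuousAt_const).div continuousAt_id hx.ne'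
      simpa [ContinuousAt] using this
    obtain ⟨l, hl, hlx⟩ := exists_Ioc_subset_of_mem_nhds (hlim.eventually_const_lt hy) ⟨0, hx⟩
    obtain ⟨t, hlt, htx⟩ := exists_between (max_lt hl hx)
    obtain ⟨i, hi⟩ := (TopologicalSpace.denseRange_denseSeq (Set.Ioi (0 : ℝ))).exists_mem_open
      (isOpen_Ioo.preimage continuous_subtype_val : IsOpen (Subtype.val ⁻¹' Set.Ioo (max l 0) x))
      ⟨⟨t, (le_max_right l 0).trans_lt hlt⟩, hlt, htx⟩
    have hqi : max l 0 < q i ∧ q i < x := hi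
    have hy' : y < f (q i) + (f (q i) - f 0) / q i * (x - q i) :=
      hlx ⟨(le_max_left l 0).trans_lt hqi.1, hqi.2.le⟩
    have hy'' : y < d i * x + (f (q i) - d i * q i) := by
      have := mul_le_mul_of_nonneg_right (hd₀ i) (sub_nonneg.2 hqi.2.le)
      linarith
    filter_upwards [eventually_ge_atTop i] with n hn
    exact (Finset.lt_sup'_iff _).2 ⟨i, Finset.mem_range.2 (Nat.lt_succ_of_le hn), hy''⟩
  · exact ((Finset.sup'_le_iff _ _).2 fun i _ ↦ hle i x hx.le).trans_lt hy

end Convex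

section LogSumExp

variable {ι : Type*} {s : Finset ι} {a b : ι → ℝ} {β : ℝ}

lemma sup'_le_log_sum_exp (hs : s.Nonempty) (hβ : 0 < β) (u : ι → ℝ) :
    s.sup' hs u ≤ β⁻¹ * log (∑ i ∈ s, exp (β * u i)) := by
  refine (Finset.sup'_le_iff _ _).2 fun i hi ↦ ?_
  rw [le_inv_mul_iff₀ hβ, ← log_exp (β * u i)]
  exact log_le_log (exp_pos _)
    (Finset.single_le_sum (f := fun i ↦ exp (β * u i)) (fun j _ ↦ (exp_pos _).le) hi)

lemma log_sum_exp_le_sup'_add (hs : s.Nonempty) (hβ : 0 < β) (u : ι → ℝ) :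
    β⁻¹ * log (∑ i ∈ s, exp (β * u i)) ≤ s.sup' hs u + log s.card * β⁻¹ := by
  have hc : (0 : ℝ) < s.card := by exact_mod_cast hs.card_pos
  have h : ∑ i ∈ s, exp (β * u i) ≤ s.card * exp (β * s.sup' hs u) := by
    rw [← nsmul_eq_mul]
    refine Finset.sum_le_card_nsmul _ _ _ fun i hi ↦ exp_le_exp.2 ?_
    exact mul_le_mul_of_nonneg_left (Finset.le_sup' u hi) hβ.le
  have h' := log_le_log (Finset.sum_pos (fun i _ ↦ exp_pos _) hs) h
  rw [log_mul hc.ne' (exp_pos _).ne', log_exp] at h'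
  calc _ ≤ β⁻¹ * (log s.card + β * s.sup' hs u) := by gcongr
    _ = _ := by field_simp; ring

lemma hasDerivAt_sum_mul_exp (c : ι → ℝ) (x : ℝ) :
    HasDerivAt (fun x ↦ ∑ i ∈ s, c i * exp (β * (a i * x + b i)))
      (β * ∑ i ∈ s, c i * a i * exp (β * (a i * x + b i))) x := by
  rw [Finset.mul_sum]
  refine HasDerivAt.fun_sum fun i _ ↦ ?_
  exact (((((hasDerivAt_id' x).const_mul (a i)).add_const (b i)).const_mul β).exp.const_mul
    (c i)).congr_deriv (by ring)

end LogSumExp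

lemma integrable_sup'_affine_comp {Ω : Type*} [MeasurableSpace Ω] {μ : Measure Ω}
    [IsFiniteMeasure μ] {X : Ω → ℝ} (hX : Integrable X μ) {ι : Type*} {s : Finset ι}
    (hs : s.Nonempty) (a b : ι → ℝ) :
    Integrable (fun ω ↦ s.sup' hs fun i ↦ a i * X ω + b i) μ := by
  have : (fun ω ↦ s.sup' hs fun i ↦ a i * X ω + b i) = s.sup' hs fun i ω ↦ a i * X ω + b i := by
    ext ω
    rw [Finset.sup'_apply]
  rw [this]
  exact Finset.sup'_induction (p := fun F ↦ Integrable F μ) hs _ (fun _ h _ h' ↦ h.sup h')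
    fun i _ ↦ (hX.const_mul (a i)).add (integrable_const _)

section Comparison

variable {Ω : Type*} [MeasureSpace Ω] [IsProbabilityMeasure (ℙ : Measure Ω)]
  {K : Set (EuclideanSpace ℝ (Fin 2))} {Γ₁ Γ₂ : Ω → EuclideanSpace ℝ (Fin 2) → ℝ}
  {C₁ C₂ : EuclideanSpace ℝ (Fin 2) → EuclideanSpace ℝ (Fin 2) → ℝ}

/-- Comparison for a smooth approximation of the maximum of finitely many affine functions. -/
lemma integral_log_sum_exp_mass_le (hK : IsCompact K)
    (h₁ : IsContGaussianField K Γ₁ C₁) (h₂ : IsContGaussianField K Γ₂ C₂)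
    (hle : ∀ z ∈ K, ∀ w ∈ K, C₁ z w ≤ C₂ z w) (hne : K.Nonempty)
    {ι : Type*} {s : Finset ι} (hs : s.Nonempty) (a b : ι → ℝ) {β : ℝ} (hβ : 0 < β) :
    ∫ ω, β⁻¹ * log (∑ i ∈ s, exp (β * (a i * (∫ z in K, exp (Γ₁ ω z - C₁ z z / 2)) + b i))) ≤
      ∫ ω, β⁻¹ * log (∑ i ∈ s, exp (β * (a i * (∫ z in K, exp (Γ₂ ω z - C₂ z z / 2)) + b i))) := by
  set e : ι → ℝ → ℝ := fun i x ↦ exp (β * (a i * x + b i)) with he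
  have he0 : ∀ i x, 0 < e i x := fun i x ↦ exp_pos _
  set Z : ℝ → ℝ := fun x ↦ ∑ i ∈ s, e i x with hZ
  set Z₁ : ℝ → ℝ := fun x ↦ ∑ i ∈ s, a i * e i x with hZ₁
  set Z₂ : ℝ → ℝ := fun x ↦ ∑ i ∈ s, a i * a i * e i x with hZ₂
  have hZ0 : ∀ x, 0 < Z x := fun x ↦ Finset.sum_pos (fun i _ ↦ he0 i x) hs
  have hdZ : ∀ x, HasDerivAt Z (β * Z₁ x) x := fun x ↦ by
    simpa [hZ, hZ₁, he] using hasDerivAt_sum_mul_exp (s := s) (a := a) (b := b) (β := β) 1 x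
  have hdZ₁ : ∀ x, HasDerivAt Z₁ (β * Z₂ x) x := fun x ↦ hasDerivAt_sum_mul_exp a x
  obtain ⟨A, hA⟩ : ∃ A, ∀ i ∈ s, |a i| ≤ A :=
    ⟨s.sup' hs fun i ↦ |a i|, fun i hi ↦ Finset.le_sup' (fun i ↦ |a i|) hi⟩
  have hA0 : 0 ≤ A := (abs_nonneg _).trans (hA _ hs.choose_spec)
  have hZ₁Z : ∀ x, |Z₁ x| ≤ A * Z x := fun x ↦ by
    rw [hZ₁, hZ, Finset.mul_sum]
    refine (Finset.abs_sum_le_sum_abs _ _).trans (Finset.sum_le_sum fun i hi ↦ ?_)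
    rw [abs_mul, abs_of_pos (he0 i x)]
    exact mul_le_mul_of_nonneg_right (hA i hi) (he0 i x).le
  have hZ₂Z : ∀ x, Z₂ x ≤ A ^ 2 * Z x := fun x ↦ by
    rw [hZ₂, hZ, Finset.mul_sum]
    refine Finset.sum_le_sum fun i hi ↦ mul_le_mul_of_nonneg_right ?_ (he0 i x).le
    rw [← sq, ← sq_abs]
    exact pow_le_pow_left₀ (abs_nonneg _) (hA i hi) 2
  have hCS : ∀ x, Z₁ x ^ 2 ≤ Z₂ x * Z x := fun x ↦
    Finset.sum_sq_le_sum_mul_sum_of_sq_le_mul s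
      (fun i _ ↦ mul_nonneg (mul_self_nonneg _) (he0 i x).le) (fun i _ ↦ (he0 i x).le)
      fun i _ ↦ le_of_eq (by ring)
  have hf''0 : ∀ x, 0 ≤ β * (Z₂ x * Z x - Z₁ x ^ 2) / Z x ^ 2 := fun x ↦
    div_nonneg (mul_nonneg hβ.le (sub_nonneg.2 (hCS x))) (sq_nonneg _)
  refine integral_comp_mass_le_of_hasDerivAt hK h₁ h₂ hle hne
    (f := fun x ↦ β⁻¹ * log (Z x)) (f' := fun x ↦ Z₁ x / Z x)
    (f'' := fun x ↦ β * (Z₂ x * Z x - Z₁ x ^ 2) / Z x ^ 2) (C := max A (β * A ^ 2))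
    (fun x ↦ ?_) (fun x ↦ ?_) ?_ (fun x ↦ ?_) (fun x ↦ ?_) hf''0
  · exact (((hdZ x).log (hZ0 x).ne').const_mul β⁻¹).congr_deriv (by field_simp)
  · exact ((hdZ₁ x).fun_div (hdZ x) (hZ0 x).ne').congr_deriv (by ring)
  · fun_prop
  · refine le_max_of_le_left ?_
    rw [abs_div, abs_of_pos (hZ0 x), div_le_iff₀ (hZ0 x)]
    exact hZ₁Z x
  · refine le_max_of_le_right ?_
    rw [abs_of_nonneg (hf''0 x), div_le_iff₀ (pow_pos (hZ0 x) 2), mul_assoc]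
    refine mul_le_mul_of_nonneg_left ?_ hβ.le
    nlinarith [mul_le_mul_of_nonneg_right (hZ₂Z x) (hZ0 x).le, sq_nonneg (Z₁ x)]

/-- Comparison for the maximum of finitely many affine functions. -/
lemma integral_sup'_affine_mass_le (hK : IsCompact K) (hKpos : 0 < volume K)
    (h₁ : IsContGaussianField K Γ₁ C₁) (h₂ : IsContGaussianField K Γ₂ C₂)
    (hle : ∀ z ∈ K, ∀ w ∈ K, C₁ z w ≤ C₂ z w)
    {ι : Type*} {s : Finset ι} (hs : s.Nonempty) (a b : ι → ℝ) :
    ∫ ω, s.sup' hs (fun i ↦ a i * (∫ z in K, exp (Γ₁ ω z - C₁ z z / 2)) + b i) ≤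
      ∫ ω, s.sup' hs (fun i ↦ a i * (∫ z in K, exp (Γ₂ ω z - C₂ z z / 2)) + b i) := by
  have hM₁ : Integrable fun ω ↦ ∫ z in K, exp (Γ₁ ω z - C₁ z z / 2) := by
    simpa using h₁.integrable_mass_pow hK hKpos 1
  have hM₂ : Integrable fun ω ↦ ∫ z in K, exp (Γ₂ ω z - C₂ z z / 2) := by
    simpa using h₂.integrable_mass_pow hK hKpos 1
  have hF₁ := integrable_sup'_affine_comp hM₁ hs a b
  have hF₂ := integrable_sup'_affine_comp hM₂ hs a b
  have hlog : ∀ {X : Ω → ℝ} {β : ℝ}, 0 < β → Integrable X → Integrable fun ω ↦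
      β⁻¹ * log (∑ i ∈ s, exp (β * (a i * X ω + b i))) := by
    intro X β hβ hX
    have hF := integrable_sup'_affine_comp hX hs a b
    refine integrable_of_le_of_le (f := fun ω ↦ β⁻¹ * log (∑ i ∈ s, exp (β * (a i * X ω + b i))))
      ?_ (ae_of_all _ fun ω ↦ sup'_le_log_sum_exp hs hβ _)
      (ae_of_all _ fun ω ↦ log_sum_exp_le_sup'_add hs hβ _) hF (hF.add (integrable_const _))
    have := hX.aemeasurable
    exact AEMeasurable.aestronglyMeasurable (by fun_prop)
  have hlim : Filter.Tendsto (fun β : ℝ ↦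
      (∫ ω, s.sup' hs (fun i ↦ a i * (∫ z in K, exp (Γ₂ ω z - C₂ z z / 2)) + b i)) +
        log s.card * β⁻¹) Filter.atTop (nhds
      (∫ ω, s.sup' hs (fun i ↦ a i * (∫ z in K, exp (Γ₂ ω z - C₂ z z / 2)) + b i))) := by
    simpa using tendsto_const_nhds.add (tendsto_inv_atTop_zero.const_mul (log s.card))
  refine ge_of_tendsto hlim ((Filter.eventually_gt_atTop 0).mono fun β hβ ↦ ?_)
  calc ∫ ω, s.sup' hs (fun i ↦ a i * (∫ z in K, exp (Γ₁ ω z - C₁ z z / 2)) + b i)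
    _ ≤ ∫ ω, β⁻¹ * log (∑ i ∈ s, exp (β * (a i * (∫ z in K, exp (Γ₁ ω z - C₁ z z / 2)) + b i))) :=
        integral_mono hF₁ (hlog hβ hM₁) fun ω ↦ sup'_le_log_sum_exp hs hβ _
    _ ≤ ∫ ω, β⁻¹ * log (∑ i ∈ s, exp (β * (a i * (∫ z in K, exp (Γ₂ ω z - C₂ z z / 2)) + b i))) :=
        integral_log_sum_exp_mass_le hK h₁ h₂ hle (nonempty_of_measure_ne_zero hKpos.ne') hs a b hβ
    _ ≤ ∫ ω, (s.sup' hs (fun i ↦ a i * (∫ z in K, exp (Γ₂ ω z - C₂ z z / 2)) + b i) +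
          log s.card * β⁻¹) :=
        integral_mono (hlog hβ hM₂) (hF₂.add (integrable_const _))
          fun ω ↦ log_sum_exp_le_sup'_add hs hβ _
    _ = _ := by rw [integral_add hF₂ (integrable_const _)]; simp

/-- **Kahane's convexity inequality**, convex case. -/
lemma integral_convexOn_mass_le (hK : IsCompact K) (hKpos : 0 < volume K)
    (h₁ : IsContGaussianField K Γ₁ C₁) (h₂ : IsContGaussianField K Γ₂ C₂)
    (hle : ∀ z ∈ K, ∀ w ∈ K, C₁ z w ≤ C₂ z w) {f : ℝ → ℝ} (hf : ConvexOn ℝ (Set.Ici 0) f)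
    {c : ℝ} {p : ℕ} (hpoly : ∀ x : ℝ, 0 ≤ x → |f x| ≤ c * (1 + x) ^ p) :
    ∫ ω, f (∫ z in K, exp (Γ₁ ω z - C₁ z z / 2)) ≤
      ∫ ω, f (∫ z in K, exp (Γ₂ ω z - C₂ z z / 2)) := by
  obtain ⟨a, b, hab, hlim⟩ := hf.exists_tendsto_sup'_affine
  have hc : 0 ≤ c := by simpa using (abs_nonneg _).trans (hpoly 0 le_rfl)
  have key : ∀ {Γ : Ω → EuclideanSpace ℝ (Fin 2) → ℝ} {C}, IsContGaussianField K Γ C →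
      Filter.Tendsto (fun n : ℕ ↦ ∫ ω, (Finset.range (n + 1)).sup' Finset.nonempty_range_add_one
        fun i ↦ a i * (∫ z in K, exp (Γ ω z - C z z / 2)) + b i) Filter.atTop
        (nhds (∫ ω, f (∫ z in K, exp (Γ ω z - C z z / 2)))) := by
    intro Γ C h
    have hM₁ : Integrable fun ω ↦ ∫ z in K, exp (Γ ω z - C z z / 2) := by
      simpa using h.integrable_mass_pow hK hKpos 1
    have hM0 : ∀ ω, 0 ≤ ∫ z in K, exp (Γ ω z - C z z / 2) := fun ω ↦
      integral_nonneg fun _ ↦ (exp_pos _).le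
    refine tendsto_integral_of_dominated_convergence (fun ω ↦
      (|a 0| * (∫ z in K, exp (Γ ω z - C z z / 2)) + |b 0|) +
        c * (2 ^ (p - 1) * (1 + (∫ z in K, exp (Γ ω z - C z z / 2)) ^ p)))
      (fun n ↦ (integrable_sup'_affine_comp hM₁ _ a b).aestronglyMeasurable) ?_
      (fun n ↦ ae_of_all _ fun ω ↦ ?_)
      ((h.ae_mass_pos hK hKpos).mono fun ω hω ↦ hlim _ hω)
    · exact ((hM₁.const_mul _).add (integrable_const _)).add
        ((((integrable_const 1).add (h.integrable_mass_pow hK hKpos p)).const_mul _).const_mul _)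
    · have hM0 := hM0 ω
      set m := ∫ z in K, exp (Γ ω z - C z z / 2)
      have hup : (Finset.range (n + 1)).sup' Finset.nonempty_range_add_one
          (fun i ↦ a i * m + b i) ≤ f m := (Finset.sup'_le_iff _ _).2 fun i _ ↦ hab i m hM0
      have hlow : a 0 * m + b 0 ≤ (Finset.range (n + 1)).sup' Finset.nonempty_range_add_one
          (fun i ↦ a i * m + b i) :=
        Finset.le_sup' (fun i ↦ a i * m + b i) (Finset.mem_range.2 n.succ_pos)
      have hpow : (1 + m) ^ p ≤ 2 ^ (p - 1) * (1 + m ^ p) := by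
        simpa using add_pow_le zero_le_one hM0 p
      have hfm : f m ≤ c * (2 ^ (p - 1) * (1 + m ^ p)) :=
        (le_abs_self _).trans ((hpoly m hM0).trans (mul_le_mul_of_nonneg_left hpow hc))
      have h0 : |a 0 * m + b 0| ≤ |a 0| * m + |b 0| := by
        simpa [abs_mul, abs_of_nonneg hM0] using abs_add_le (a 0 * m) (b 0)
      have hc' : 0 ≤ c * (2 ^ (p - 1) * (1 + m ^ p)) := by positivity
      rw [norm_eq_abs, abs_le]
      constructor
      · linarith [(abs_le.1 h0).1]
      · linarith [abs_nonneg (a 0 * m + b 0)]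
  exact le_of_tendsto_of_tendsto (key h₁) (key h₂) (Filter.Eventually.of_forall fun n ↦
    integral_sup'_affine_mass_le hK hKpos h₁ h₂ hle _ a b)

end Comparison

/-- **Kahane's convexity inequality.** If `Γ₁, Γ₂` are continuous centered Gaussian fields on a
compact `K ⊂ ℝ²` of positive Lebesgue measure with covariance kernels `C₁ ≤ C₂` pointwise on
`K × K`, then for every convex `f : [0,∞) → ℝ` of at most polynomial growth,
`E[f(∫_K e^{Γ₁(z) − C₁(z,z)/2} dz)] ≤ E[f(∫_K e^{Γ₂(z) − C₂(z,z)/2} dz)]`,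
and the opposite inequality holds for concave `f` of at most polynomial growth. -/
theorem kahane_convexity_inequality
    {Ω : Type*} [MeasureSpace Ω] [IsProbabilityMeasure (ℙ : Measure Ω)]
    (K : Set (EuclideanSpace ℝ (Fin 2))) (hK : IsCompact K) (hKpos : 0 < volume K)
    (Γ₁ Γ₂ : Ω → EuclideanSpace ℝ (Fin 2) → ℝ)
    (C₁ C₂ : EuclideanSpace ℝ (Fin 2) → EuclideanSpace ℝ (Fin 2) → ℝ)
    (h₁ : IsContGaussianField K Γ₁ C₁) (h₂ : IsContGaussianField K Γ₂ C₂)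
    (hle : ∀ z ∈ K, ∀ w ∈ K, C₁ z w ≤ C₂ z w)
    (f : ℝ → ℝ) (hpoly : ∃ (c : ℝ) (p : ℕ), ∀ x : ℝ, 0 ≤ x → |f x| ≤ c * (1 + x) ^ p) :
    (ConvexOn ℝ (Set.Ici (0 : ℝ)) f →
      (∫ ω, f (∫ z in K, Real.exp (Γ₁ ω z - C₁ z z / 2))) ≤
      (∫ ω, f (∫ z in K, Real.exp (Γ₂ ω z - C₂ z z / 2)))) ∧
    (ConcaveOn ℝ (Set.Ici (0 : ℝ)) f →
      (∫ ω, f (∫ z in K, Real.exp (Γ₂ ω z - C₂ z z / 2))) ≤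
      (∫ ω, f (∫ z in K, Real.exp (Γ₁ ω z - C₁ z z / 2)))) := by
  obtain ⟨c, p, hc⟩ := hpoly
  refine ⟨fun hf ↦ integral_convexOn_mass_le hK hKpos h₁ h₂ hle hf hc, fun hf ↦ ?_⟩
  have h := integral_convexOn_mass_le hK hKpos h₁ h₂ hle (f := fun x ↦ -f x) hf.neg
    fun x hx ↦ (abs_neg (f x)).trans_le (hc x hx)
  rw [integral_neg, integral_neg] at h
  exact neg_le_neg_iff.1 h
end

section
/- Let X be a centered Gaussian random variable with variance σ² ≥ 0, let c ∈ ℝ, and let g : ℝ → ℝ be a bounded monotone nondecreasing function. Then E[(X − cσ²) e^{cX − c²σ²/2} g(X)] ≥ 0. -/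
open MeasureTheory ProbabilityTheory Real

lemma gaussianPDFReal_zero_mul_exp (v : NNReal) (hv : v ≠ 0) (c x : ℝ) :
    gaussianPDFReal 0 v x * Real.exp (c * x - c ^ 2 * (v : ℝ) / 2)
      = gaussianPDFReal (c * v) v x := by
  have hv' : (v : ℝ) ≠ 0 := by exact_mod_cast hv
  simp only [gaussianPDFReal]
  rw [mul_assoc, ← Real.exp_add]
  congr 2
  field_simp
  ring

/-- Cameron–Martin formula on the real line. -/
lemma integral_exp_mul_gaussianReal_zero (v : NNReal) (c : ℝ) (f : ℝ → ℝ) :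
    ∫ x, Real.exp (c * x - c ^ 2 * (v : ℝ) / 2) * f x ∂gaussianReal 0 v
      = ∫ x, f x ∂gaussianReal (c * v) v := by
  by_cases hv : v = 0
  · simp [hv]
  · rw [integral_gaussianReal_eq_integral_smul hv, integral_gaussianReal_eq_integral_smul hv]
    simp only [smul_eq_mul, ← mul_assoc, gaussianPDFReal_zero_mul_exp v hv]

/-- A bounded monotone function of a real Gaussian variable is nonnegatively correlated with it. -/
lemma integral_sub_mean_mul_monotone_nonneg (m : ℝ) (v : NNReal) {g : ℝ → ℝ} (hg : Monotone g)
    (hgbdd : ∃ B : ℝ, ∀ x, |g x| ≤ B) :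
    0 ≤ ∫ x, (x - m) * g x ∂gaussianReal m v := by
  obtain ⟨B, hB⟩ := hgbdd
  have hid : Integrable (fun x : ℝ ↦ x) (gaussianReal m v) :=
    (memLp_id_gaussianReal 1).integrable le_rfl
  have hsub : Integrable (fun x : ℝ ↦ x - m) (gaussianReal m v) := hid.sub (integrable_const m)
  have hzero : ∫ x, (x - m) * g m ∂gaussianReal m v = 0 := by
    rw [integral_mul_const, integral_sub hid (integrable_const m), integral_id_gaussianReal]
    simp
  rw [← hzero]
  refine integral_mono (hsub.mul_const _)
    (hsub.mul_bdd hg.measurable.aestronglyMeasurable (.of_forall hB)) fun x ↦ ?_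
  rcases le_total m x with h | h
  · exact mul_le_mul_of_nonneg_left (hg h) (sub_nonneg.2 h)
  · exact mul_le_mul_of_nonpos_left (hg h) (sub_nonpos.2 h)



/-- If `X` is a centered Gaussian random variable with variance `σ² ≥ 0`, `c ∈ ℝ` and
`g : ℝ → ℝ` is bounded and monotone nondecreasing, then
`E[(X − cσ²) e^{cX − c²σ²/2} g(X)] ≥ 0`. -/
theorem gaussian_tilted_monotone_nonneg
    {Ω : Type*} [MeasureSpace Ω] [IsProbabilityMeasure (ℙ : Measure Ω)]
    (X : Ω → ℝ) (hXmeas : Measurable X) (σ2 : NNReal)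
    (hlaw : Measure.map X (ℙ : Measure Ω) = gaussianReal 0 σ2)
    (c : ℝ) (g : ℝ → ℝ) (hg : Monotone g) (hgbdd : ∃ B : ℝ, ∀ x, |g x| ≤ B) :
    0 ≤ ∫ ω, (X ω - c * (σ2 : ℝ)) *
        Real.exp (c * X ω - c ^ 2 * (σ2 : ℝ) / 2) * g (X ω) := by
  have hmeas : Measurable fun x : ℝ ↦
      (x - c * (σ2 : ℝ)) * Real.exp (c * x - c ^ 2 * (σ2 : ℝ) / 2) * g x := by
    have := hg.measurable
    fun_prop
  rw [← integral_map hXmeas.aemeasurable hmeas.aestronglyMeasurable, hlaw]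
  convert integral_sub_mean_mul_monotone_nonneg (c * σ2) σ2 hg hgbdd using 1
  rw [← integral_exp_mul_gaussianReal_zero]
  congr with x
  ring
end
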